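/- arXiv:1710.08748 — 4 statements merged into one kernel-verified Lean document; each statement's English description precedes it below -/
import Mathlib

section
/- For every BUDTA A given in semigroup form one can effectively construct a BUDTA A' in semigroup form that is in normal form (i.e., satisfies (NF1) and (NF2)) and accepts exactly the same data trees as A. -/
namespace SGB

/-- Positions in an unranked tree: finite sequences of natural numbers. -/
abbrev Pos : Type := List ℕ

/-- A data tree over a label alphabet `A` and data domain `D`. -/
structure DataTree (A D : Type) where
  pos : Finset Pos
  label : Pos → A
  data : Pos → D
  root_mem : ([] : Pos) ∈ pos
  parent_closed : ∀ (x : Pos) (i : ℕ), x ++ [i] ∈ pos → x ∈ pos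
  sibling_closed : ∀ (x : Pos) (i : ℕ), x ++ [i + 1] ∈ pos → x ++ [i] ∈ pos

def IsLeaf {A D : Type} (τ : DataTree A D) (x : Pos) : Prop :=
  ∀ i : ℕ, x ++ [i] ∉ τ.pos

/-- `p` is a downward path of `τ` starting at `x`. -/
def IsDownPath {A D : Type} (τ : DataTree A D) (x : Pos) (p : List Pos) : Prop :=
  p ≠ [] ∧ p.head? = some x ∧ (∀ y ∈ p, y ∈ τ.pos) ∧
    List.Chain' (fun y z => ∃ i : ℕ, z = y ++ [i]) p

def subtreeData {A D : Type} (τ : DataTree A D) (x : Pos) : Set D :=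
  {d | ∃ y ∈ τ.pos, x <+: y ∧ τ.data y = d}

/-- Evaluation of a nonempty word under the semigroup homomorphism determined
by the letter map `h` (and `none` on the empty word). -/
def hword {A B S : Type} [Mul S] (h : A × B → S) : List (A × B) → Option S
  | [] => none
  | c :: w => some (w.foldl (fun s x => s * h x) (h c))

/-- Basic tests of a BUDTA in semigroup form: the downward-path tests carry a
semigroup element `μ ∈ S` instead of a regular expression. -/
inductive SBTest (A B Q S : Type) : Type where
  | state : Q → SBTest A B Q S
  | eq : SBTest A B Q S
  | deq : S → SBTest A B Q S          -- ⟨μ⟩^=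
  | dneq : S → SBTest A B Q S         -- ⟨μ⟩^≠
  | root : SBTest A B Q S
  | leaf : SBTest A B Q S
  | lab : A → SBTest A B Q S
  | ilab : B → SBTest A B Q S

inductive BAct (Q : Type) : Type where
  | accept : BAct Q
  | keep : Q → BAct Q
  | store : Q → BAct Q
  | guess : Q → BAct Q
  | univ : Q → BAct Q

/-- A transition: a conjunction of possibly negated basic tests (`true` marks
negation) with a conjunction of basic actions. -/
abbrev STrans (A B Q S : Type) : Type := List (Bool × SBTest A B Q S) × List (BAct Q)

def sBasicHolds {A B Q S D : Type} [Mul S] (h : A × B → S)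
    (τ : DataTree A D) (bl : Pos → B) (x : Pos) (q : Q) (d : D) :
    SBTest A B Q S → Prop
  | .state p => q = p
  | .eq => τ.data x = d
  | .deq μ => ∃ p y, IsDownPath τ x p ∧ p.getLast? = some y ∧
      hword h (p.map fun z => (τ.label z, bl z)) = some μ ∧ τ.data y = d
  | .dneq μ => ∃ p y, IsDownPath τ x p ∧ p.getLast? = some y ∧
      hword h (p.map fun z => (τ.label z, bl z)) = some μ ∧ τ.data y ≠ d
  | .root => x = ([] : Pos)
  | .leaf => IsLeaf τ x
  | .lab a => τ.label x = a
  | .ilab b => bl x = b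

def sTestHolds {A B Q S D : Type} [Mul S] (h : A × B → S)
    (τ : DataTree A D) (bl : Pos → B) (x : Pos) (q : Q) (d : D)
    (t : List (Bool × SBTest A B Q S)) : Prop :=
  ∀ nt ∈ t, (sBasicHolds h τ bl x q d nt.2 ↔ nt.1 = false)

def actOK {A Q D : Type} (τ : DataTree A D) (x y : Pos)
    (ρ : Pos → Set (Q × D)) (d : D) : BAct Q → Prop
  | .accept => True
  | .keep p => (p, d) ∈ ρ y
  | .store p => (p, τ.data x) ∈ ρ y
  | .guess p => ∃ e : D, (p, e) ∈ ρ y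
  | .univ p => ∀ e ∈ subtreeData τ x, (p, e) ∈ ρ y

def SIsRun {A B Q S D : Type} [Mul S] (h : A × B → S) (q0 : Q)
    (δ : List (STrans A B Q S)) (τ : DataTree A D) (bl : Pos → B)
    (ρ : Pos → Set (Q × D)) : Prop :=
  (∀ x ∈ τ.pos, (ρ x).Finite) ∧
  (∀ x ∈ τ.pos, IsLeaf τ x → ∃ e : D, ρ x = {(q0, e)}) ∧
  (∀ (y : Pos) (i : ℕ), y ++ [i] ∈ τ.pos → ∀ qd ∈ ρ (y ++ [i]),
    ∃ tr ∈ δ, sTestHolds h τ bl (y ++ [i]) qd.1 qd.2 tr.1 ∧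
      ∀ a ∈ tr.2, actOK τ (y ++ [i]) y ρ qd.2 a)

def SIsAcceptingRun {A B Q S D : Type} [Mul S] (h : A × B → S) (q0 : Q)
    (δ : List (STrans A B Q S)) (τ : DataTree A D) (bl : Pos → B)
    (ρ : Pos → Set (Q × D)) : Prop :=
  SIsRun h q0 δ τ bl ρ ∧
  ∀ qd ∈ ρ ([] : Pos), ∃ t, (t, [BAct.accept]) ∈ δ ∧ sTestHolds h τ bl [] qd.1 qd.2 t

/-- A BUDTA in semigroup form over the alphabet `A`. -/
structure SGBUDTA (A : Type) : Type 1 where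
  B : Type
  Bfin : Finite B
  Q : Type
  Qfin : Finite Q
  S : Type
  Sfin : Finite S
  sg : Semigroup S
  q0 : Q
  h : A × B → S
  δ : List (STrans A B Q S)

def SAccepts {A D : Type} (M : SGBUDTA A) (τ : DataTree A D) : Prop :=
  letI : Semigroup M.S := M.sg
  ∃ bl : Pos → M.B, ∃ ρ : Pos → Set (M.Q × D),
    SIsAcceptingRun M.h M.q0 M.δ τ bl ρ

/-- (NF1): distinct values for words of length one: `h(w) = h(c)` iff `w = c`. -/
def NF1 {A B S : Type} [Mul S] (h : A × B → S) : Prop :=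
  ∀ (w : List (A × B)) (c : A × B), hword h w = some (h c) ↔ w = [c]

/-- (NF2): a basic test allowed in normal form: state tests, `⟨μ⟩^=`, `⟨μ⟩^≠`
and `root` only. -/
def NF2test {A B Q S : Type} : SBTest A B Q S → Prop
  | .state _ => True
  | .deq _ => True
  | .dneq _ => True
  | .root => True
  | _ => False

/-- The automaton is in normal form: (NF1) and (NF2). -/
def NormalForm {A : Type} (M : SGBUDTA A) : Prop :=
  letI : Semigroup M.S := M.sg
  NF1 M.h ∧ ∀ tr ∈ M.δ, ∀ nt ∈ tr.1, NF2test nt.2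

/-- Extended semigroup `C ⊕ S`: letters are kept apart from all products. -/
def ExtSG.ev {C S : Type} (h : C → S) : C ⊕ S → S
  | .inl c => h c
  | .inr s => s

def extSG {C S : Type} [Semigroup S] (h : C → S) : Semigroup (C ⊕ S) where
  mul x y := .inr (ExtSG.ev h x * ExtSG.ev h y)
  mul_assoc x y z := congrArg Sum.inr (mul_assoc (ExtSG.ev h x) (ExtSG.ev h y) (ExtSG.ev h z))

section NF
variable {A B Q S D : Type} [Semigroup S] (h : A × B → S)

abbrev hx (A B S : Type) : A × B → (A × B) ⊕ S := Sum.inl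

theorem foldl_ext (w : List (A × B)) (s : S) :
    letI := extSG h
    w.foldl (fun s x => s * hx A B S x) (Sum.inr s : (A × B) ⊕ S)
      = Sum.inr (w.foldl (fun s x => s * h x) s) := by
  letI := extSG h
  induction w generalizing s with
  | nil => rfl
  | cons c w ih => exact ih (s * h c)

theorem hword_inl (w : List (A × B)) (c : A × B) :
    letI := extSG h
    hword (hx A B S) w = some (Sum.inl c) ↔ w = [c] := by
  letI := extSG h
  match w with
  | [] => simp [hword]
  | [e] => simp [hword]
  | e :: f :: w =>
    have := foldl_ext h w (h e * h f)
    have h2 : hword (hx A B S) (e :: f :: w) = some (Sum.inr _) := congrArg some this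
    constructor
    · intro h3
      rw [h2] at h3
      simp at h3
    · intro h3
      simp at h3

theorem hword_inr (w : List (A × B)) (μ : S) :
    letI := extSG h
    hword (hx A B S) w = some (Sum.inr μ) ↔ 2 ≤ w.length ∧ hword h w = some μ := by
  letI := extSG h
  match w with
  | [] => simp [hword]
  | [e] => simp [hword]
  | e :: f :: w =>
    have := foldl_ext h w (h e * h f)
    have h2 : hword (hx A B S) (e :: f :: w) = some (Sum.inr _) := congrArg some this
    rw [h2]
    simp [hword]

theorem hword_split (w : List (A × B)) (μ : S) :
    hword h w = some μ ↔ (2 ≤ w.length ∧ hword h w = some μ) ∨ ∃ c, h c = μ ∧ w = [c] := by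
  match w with
  | [] => simp [hword]
  | [e] => simp [hword]
  | e :: f :: w => simp

abbrev Cl (A B Q S : Type) := List (Bool × SBTest A B Q ((A × B) ⊕ S))

def holds' (τ : DataTree A D) (bl : Pos → B) (x : Pos) (q : Q) (d : D) (t : Cl A B Q S) : Prop :=
  letI := extSG h
  sTestHolds (hx A B S) τ bl x q d t

def basic' (τ : DataTree A D) (bl : Pos → B) (x : Pos) (q : Q) (d : D)
    (t : SBTest A B Q ((A × B) ⊕ S)) : Prop :=
  letI := extSG h
  sBasicHolds (hx A B S) τ bl x q d t

/-- Expressible by a finite disjunction of normal form clauses. -/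
def Ex (P : DataTree A D → (Pos → B) → Pos → Q → D → Prop) : Prop :=
  ∃ L : List (Cl A B Q S), (∀ c ∈ L, ∀ nt ∈ c, NF2test nt.2) ∧
    ∀ τ bl x q d, x ∈ τ.pos → ((∃ c ∈ L, holds' h τ bl x q d c) ↔ P τ bl x q d)

variable {h}
variable {P R : DataTree A D → (Pos → B) → Pos → Q → D → Prop}

theorem Ex.congr (hP : Ex h P)
    (e : ∀ τ bl x q d, x ∈ τ.pos → (P τ bl x q d ↔ R τ bl x q d)) : Ex h R := by
  obtain ⟨L, h1, h2⟩ := hP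
  exact ⟨L, h1, fun τ bl x q d hx => (h2 τ bl x q d hx).trans (e τ bl x q d hx)⟩

theorem Ex.top : Ex h (fun (_ : DataTree A D) (_ : Pos → B) _ (_ : Q) _ => True) :=
  ⟨[[]], by simp, by simp [holds', sTestHolds]⟩

theorem Ex.bot : Ex h (fun (_ : DataTree A D) (_ : Pos → B) _ (_ : Q) _ => False) :=
  ⟨[], by simp, by simp⟩

theorem Ex.or (hP : Ex h P) (hR : Ex h R) :
    Ex h (fun τ bl x q d => P τ bl x q d ∨ R τ bl x q d) := by
  obtain ⟨L, h1, h2⟩ := hP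
  obtain ⟨L', h1', h2'⟩ := hR
  refine ⟨L ++ L', ?_, fun τ bl x q d hx => ?_⟩
  · intro c hc
    rcases List.mem_append.1 hc with hc | hc
    · exact h1 c hc
    · exact h1' c hc
  · beta_reduce
    rw [← h2 τ bl x q d hx, ← h2' τ bl x q d hx]
    simp only [List.mem_append, or_and_right, exists_or]

theorem Ex.and (hP : Ex h P) (hR : Ex h R) :
    Ex h (fun τ bl x q d => P τ bl x q d ∧ R τ bl x q d) := by
  obtain ⟨L, h1, h2⟩ := hP
  obtain ⟨L', h1', h2'⟩ := hR
  refine ⟨L.flatMap fun c => L'.map fun c' => c ++ c', ?_, fun τ bl x q d hx => ?_⟩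
  · intro c hc nt hnt
    simp only [List.mem_flatMap, List.mem_map] at hc
    obtain ⟨a, ha, b, hb, rfl⟩ := hc
    rcases List.mem_append.1 hnt with hn | hn
    · exact h1 _ ha _ hn
    · exact h1' _ hb _ hn
  · beta_reduce
    rw [← h2 τ bl x q d hx, ← h2' τ bl x q d hx]
    simp only [List.mem_flatMap, List.mem_map]
    constructor
    · rintro ⟨c, ⟨a, ha, b, hb, rfl⟩, hc⟩
      exact ⟨⟨a, ha, fun n hn => hc n (List.mem_append_left _ hn)⟩,
        ⟨b, hb, fun n hn => hc n (List.mem_append_right _ hn)⟩⟩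
    · rintro ⟨⟨a, ha, h3⟩, b, hb, h4⟩
      refine ⟨a ++ b, ⟨a, ha, b, hb, rfl⟩, fun n hn => ?_⟩
      rcases List.mem_append.1 hn with hn | hn
      · exact h3 n hn
      · exact h4 n hn

theorem Ex.exists {ι : Type} [Finite ι] {F : ι → DataTree A D → (Pos → B) → Pos → Q → D → Prop}
    (hF : ∀ i, Ex h (F i)) : Ex h (fun τ bl x q d => ∃ i, F i τ bl x q d) := by
  haveI := Fintype.ofFinite ι
  have key : ∀ l : List ι, Ex h (fun τ bl x q d => ∃ i ∈ l, F i τ bl x q d) := by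
    intro l
    induction l with
    | nil => exact Ex.bot.congr (by simp)
    | cons i l ih => exact ((hF i).or ih).congr (by simp)
  exact (key Finset.univ.toList).congr (by simp)

theorem Ex.lit (b : Bool) {t : SBTest A B Q ((A × B) ⊕ S)} (ht : NF2test t) :
    Ex (D := D) h (fun τ bl x q d => (basic' h τ bl x q d t ↔ b = false)) :=
  ⟨[[(b, t)]], by simp only [List.mem_singleton]; rintro _ rfl n hn; rw [List.mem_singleton.1 hn]; exact ht,
    by simp only [holds', sTestHolds, basic', List.mem_singleton, exists_eq_left, forall_eq]; simp⟩

theorem Ex.basic {t : SBTest A B Q ((A × B) ⊕ S)} (ht : NF2test t) :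
    Ex (D := D) h (fun τ bl x q d => basic' h τ bl x q d t) :=
  (Ex.lit false ht).congr (by simp)

theorem Ex.not (hP : Ex h P) : Ex h (fun τ bl x q d => ¬ P τ bl x q d) := by
  obtain ⟨L, h1, h2⟩ := hP
  have clause : ∀ c : Cl A B Q S, (∀ nt ∈ c, NF2test nt.2) →
      Ex (D := D) h (fun τ bl x q d => ¬ holds' h τ bl x q d c) := by
    intro c
    induction c with
    | nil => exact fun _ => Ex.bot.congr (by simp [holds', sTestHolds])
    | cons n c ih =>
      intro hc
      refine ((Ex.lit (!n.1) (hc n (by simp))).or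
        (ih fun m hm => hc m (by simp [hm]))).congr ?_
      intro τ bl x q d _
      simp only [holds', sTestHolds, basic', List.forall_mem_cons]
      rw [not_and_or]
      refine or_congr ?_ Iff.rfl
      cases n.1 <;> simp
  have all : ∀ L : List (Cl A B Q S), (∀ c ∈ L, ∀ nt ∈ c, NF2test nt.2) →
      Ex (D := D) h (fun τ bl x q d => ¬ ∃ c ∈ L, holds' h τ bl x q d c) := by
    intro L
    induction L with
    | nil => exact fun _ => Ex.top.congr (by simp)
    | cons c L ih =>
      intro hL
      exact ((clause c (hL c (by simp))).and (ih fun m hm => hL m (by simp [hm]))).congr (by simp)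
  exact (all L h1).congr fun τ bl x q d hx => not_congr (h2 τ bl x q d hx)

theorem down_single (τ : DataTree A D) {x : Pos} (hx : x ∈ τ.pos) (p : List Pos) :
    (IsDownPath τ x p ∧ p.length = 1) ↔ p = [x] := by
  constructor
  · rintro ⟨⟨_, h2, _⟩, h4⟩
    obtain ⟨z, rfl⟩ := List.length_eq_one_iff.1 h4
    simpa using h2
  · rintro rfl
    exact ⟨⟨by simp, by simp, by simpa using hx, List.isChain_singleton _⟩, rfl⟩

theorem path_inl (τ : DataTree A D) (bl : Pos → B) {x : Pos} (hx' : x ∈ τ.pos) (c : A × B)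
    (T : D → Prop) :
    letI := extSG h
    (∃ p y, IsDownPath τ x p ∧ p.getLast? = some y ∧
      hword (hx A B S) (p.map fun z => (τ.label z, bl z)) = some (Sum.inl c) ∧ T (τ.data y))
    ↔ (τ.label x, bl x) = c ∧ T (τ.data x) := by
  letI := extSG h
  constructor
  · rintro ⟨p, y, h1, h2, h3, h4⟩
    rw [hword_inl] at h3
    have hl : p.length = 1 := by simpa using congrArg List.length h3
    obtain rfl := (down_single τ hx' p).1 ⟨h1, hl⟩
    simp at h2 h3
    subst h2
    exact ⟨h3, h4⟩
  · rintro ⟨h1, h2⟩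
    refine ⟨[x], x, ((down_single τ hx' [x]).2 rfl).1, rfl, ?_, h2⟩
    rw [hword_inl]
    simpa using h1

theorem path_any (τ : DataTree A D) (bl : Pos → B) {x : Pos} (hx' : x ∈ τ.pos) (μ : S)
    (T : D → Prop) :
    letI := extSG h
    (∃ p y, IsDownPath τ x p ∧ p.getLast? = some y ∧
      hword h (p.map fun z => (τ.label z, bl z)) = some μ ∧ T (τ.data y)) ↔
    (∃ p y, IsDownPath τ x p ∧ p.getLast? = some y ∧
      hword (hx A B S) (p.map fun z => (τ.label z, bl z)) = some (Sum.inr μ) ∧ T (τ.data y)) ∨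
    ∃ c, h c = μ ∧ ∃ p y, IsDownPath τ x p ∧ p.getLast? = some y ∧
      hword (hx A B S) (p.map fun z => (τ.label z, bl z)) = some (Sum.inl c) ∧ T (τ.data y) := by
  letI := extSG h
  constructor
  · rintro ⟨p, y, h1, h2, h3, h4⟩
    rcases (hword_split h _ _).1 h3 with h5 | ⟨c, h5, h6⟩
    · exact Or.inl ⟨p, y, h1, h2, (hword_inr h _ _).2 h5, h4⟩
    · exact Or.inr ⟨c, h5, p, y, h1, h2, (hword_inl h _ _).2 h6, h4⟩
  · rintro (⟨p, y, h1, h2, h3, h4⟩ | ⟨c, h5, p, y, h1, h2, h3, h4⟩)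
    · exact ⟨p, y, h1, h2, ((hword_inr h _ _).1 h3).2, h4⟩
    · exact ⟨p, y, h1, h2,
        (hword_split h _ _).2 (Or.inr ⟨c, h5, (hword_inl h _ _).1 h3⟩), h4⟩

theorem leaf_iff (τ : DataTree A D) (bl : Pos → B) {x : Pos} (hx' : x ∈ τ.pos) (q : Q) (d : D) :
    (¬ ∃ μ : S, basic' h τ bl x q d (.deq (.inr μ)) ∨ basic' h τ bl x q d (.dneq (.inr μ)))
      ↔ IsLeaf τ x := by
  letI := extSG h
  have : (∃ μ : S, basic' h τ bl x q d (.deq (.inr μ)) ∨ basic' h τ bl x q d (.dneq (.inr μ)))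
      ↔ ∃ i, x ++ [i] ∈ τ.pos := by
    constructor
    · have key : ∀ p : List Pos, IsDownPath τ x p → ∀ μ : S,
          hword (hx A B S) (p.map fun z => (τ.label z, bl z)) = some (Sum.inr μ) →
          ∃ i, x ++ [i] ∈ τ.pos := by
        intro p hp μ hw
        have h2 := ((hword_inr h _ _).1 hw).1
        obtain ⟨_, h3, h4, h5⟩ := hp
        match p with
        | [] => simp at h2
        | [_] => simp at h2
        | u :: v :: p =>
          simp at h3
          subst h3
          obtain ⟨i, rfl⟩ := (List.isChain_cons_cons.1 h5).1
          exact ⟨i, h4 _ (by simp)⟩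
      rintro ⟨μ, ⟨p, y, h1, h2, h3, h4⟩ | ⟨p, y, h1, h2, h3, h4⟩⟩
      · exact key p h1 μ h3
      · exact key p h1 μ h3
    · rintro ⟨i, hi⟩
      have hp : IsDownPath τ x [x, x ++ [i]] :=
        ⟨by simp, by simp, by simp [hx', hi],
          List.isChain_cons_cons.2 ⟨⟨i, rfl⟩, List.isChain_singleton _⟩⟩
      refine ⟨h (τ.label x, bl x) * h (τ.label (x ++ [i]), bl (x ++ [i])), ?_⟩
      by_cases hd : τ.data (x ++ [i]) = d
      · exact Or.inl ⟨_, _, hp, rfl, rfl, hd⟩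
      · exact Or.inr ⟨_, _, hp, rfl, rfl, hd⟩
  rw [this]
  simp [IsLeaf]

theorem Ex.test [Finite A] [Finite B] [Finite S] (t : SBTest A B Q S) :
    Ex (D := D) h (fun τ bl x q d => sBasicHolds h τ bl x q d t) := by
  have hif : ∀ (p : Prop) {P : DataTree A D → (Pos → B) → Pos → Q → D → Prop}, Ex h P →
      Ex h (fun τ bl x q d => p ∧ P τ bl x q d) := by
    intro p P hP
    by_cases hp : p
    · exact hP.congr (by simp [hp])
    · exact Ex.bot.congr (by simp [hp])
  have hl : ∀ (τ : DataTree A D) bl x (q : Q) d, x ∈ τ.pos → ∀ c,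
      (basic' h τ bl x q d (.deq (.inl c)) ∨ basic' h τ bl x q d (.dneq (.inl c)) ↔
        (τ.label x, bl x) = c) := by
    intro τ bl x q d hx' c
    have e1 : basic' h τ bl x q d (.deq (.inl c)) ↔ _ :=
      path_inl (h := h) τ bl hx' c (fun e => e = d)
    have e2 : basic' h τ bl x q d (.dneq (.inl c)) ↔ _ :=
      path_inl (h := h) τ bl hx' c (fun e => e ≠ d)
    rw [e1, e2]
    tauto
  have hlab : ∀ c : A × B, Ex (D := D) (Q := Q) h (fun τ bl x q d => (τ.label x, bl x) = c) :=
    fun c => ((Ex.basic (t := .deq (.inl c)) trivial).or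
      (Ex.basic (t := .dneq (.inl c)) trivial)).congr
        (fun τ bl x q d hx' => hl τ bl x q d hx' c)
  cases t with
  | state p => exact Ex.basic (t := .state p) trivial
  | root => exact Ex.basic (t := .root) trivial
  | eq =>
    refine (Ex.exists fun c : A × B => Ex.basic (t := .deq (.inl c)) trivial).congr ?_
    intro τ bl x q d hx'
    have e1 : ∀ c, basic' h τ bl x q d (.deq (.inl c)) ↔ _ := fun c =>
      path_inl (h := h) τ bl hx' c (fun e => e = d)
    simp only [e1]
    simp [sBasicHolds]
  | deq μ =>
    refine ((Ex.basic (t := .deq (.inr μ)) trivial).or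
      (Ex.exists fun c : A × B => hif (h c = μ) (Ex.basic (t := .deq (.inl c)) trivial))).congr ?_
    intro τ bl x q d hx'
    exact (path_any (h := h) τ bl hx' μ (fun e => e = d)).symm
  | dneq μ =>
    refine ((Ex.basic (t := .dneq (.inr μ)) trivial).or
      (Ex.exists fun c : A × B => hif (h c = μ) (Ex.basic (t := .dneq (.inl c)) trivial))).congr ?_
    intro τ bl x q d hx'
    exact (path_any (h := h) τ bl hx' μ (fun e => e ≠ d)).symm
  | leaf =>
    refine (Ex.exists fun μ : S => (Ex.basic (t := .deq (.inr μ)) trivial).or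
      (Ex.basic (t := .dneq (.inr μ)) trivial)).not.congr ?_
    intro τ bl x q d hx'
    exact leaf_iff τ bl hx' q d
  | lab a => exact (Ex.exists fun b : B => hlab (a, b)).congr (by simp [sBasicHolds])
  | ilab b => exact (Ex.exists fun a : A => hlab (a, b)).congr (by simp [sBasicHolds])

theorem Ex.tests [Finite A] [Finite B] [Finite S] (t : List (Bool × SBTest A B Q S)) :
    Ex (D := D) h (fun τ bl x q d => sTestHolds h τ bl x q d t) := by
  induction t with
  | nil => exact Ex.top.congr (by simp [sTestHolds])
  | cons n t ih =>
    have : Ex (D := D) h (fun τ bl x q d => (sBasicHolds h τ bl x q d n.2 ↔ n.1 = false)) := by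
      cases n.1
      · exact (Ex.test n.2).congr (by simp)
      · exact (Ex.test n.2).not.congr (by simp)
    exact (this.and ih).congr (by simp only [sTestHolds, List.forall_mem_cons]; simp)

end NF

theorem exists_nf (A D : Type) [Fintype A] (M : SGBUDTA A) :
    ∃ N : SGBUDTA A, NormalForm N ∧ ∀ τ : DataTree A D, SAccepts N τ ↔ SAccepts M τ := by
  obtain ⟨B, Bfin, Q, Qfin, S, Sfin, sg, q0, h, δ⟩ := M
  have hE := fun t => Ex.tests (D := D) (Q := Q) (h := h) t
  choose L hL1 hL2 using hE
  let δ' : List (STrans A B Q ((A × B) ⊕ S)) :=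
    δ.flatMap fun tr => (L tr.1).map fun c => (c, tr.2)
  have hδ : ∀ c a, (c, a) ∈ δ' ↔ ∃ t, (t, a) ∈ δ ∧ c ∈ L t := by
    intro c a
    simp only [δ', List.mem_flatMap, List.mem_map, Prod.mk.injEq]
    constructor
    · rintro ⟨⟨t, a'⟩, h1, c', h2, rfl, rfl⟩
      exact ⟨t, h1, h2⟩
    · rintro ⟨t, h1, h2⟩
      exact ⟨(t, a), h1, c, h2, rfl, rfl⟩
  refine ⟨⟨B, Bfin, Q, Qfin, (A × B) ⊕ S, inferInstance, extSG h, q0, hx A B S, δ'⟩,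
    ⟨fun w c => hword_inl h w c, ?_⟩, ?_⟩
  · rintro ⟨c, a⟩ htr nt hnt
    obtain ⟨t, _, h2⟩ := (hδ c a).1 htr
    exact hL1 t c h2 nt hnt
  · intro τ
    refine exists_congr fun bl => exists_congr fun ρ => ?_
    have step : ∀ x ∈ τ.pos, ∀ (q : Q) (d : D) (G : List (BAct Q) → Prop),
        (∃ tr ∈ δ', holds' h τ bl x q d tr.1 ∧ G tr.2) ↔
        (∃ tr ∈ δ, sTestHolds h τ bl x q d tr.1 ∧ G tr.2) := by
      intro x hx' q d G
      constructor
      · rintro ⟨⟨c, a⟩, h1, h2, h3⟩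
        obtain ⟨t, h4, h5⟩ := (hδ c a).1 h1
        exact ⟨(t, a), h4, (hL2 t τ bl x q d hx').1 ⟨c, h5, h2⟩, h3⟩
      · rintro ⟨⟨t, a⟩, h1, h2, h3⟩
        obtain ⟨c, h4, h5⟩ := (hL2 t τ bl x q d hx').2 h2
        exact ⟨(c, a), (hδ c a).2 ⟨t, h1, h4⟩, h5, h3⟩
    refine and_congr (and_congr Iff.rfl (and_congr Iff.rfl ?_)) ?_
    · exact forall_congr' fun y => forall_congr' fun i => forall_congr' fun hy =>
        forall_congr' fun qd => forall_congr' fun _ =>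
          step _ hy qd.1 qd.2 (fun l => ∀ a ∈ l, actOK τ (y ++ [i]) y ρ qd.2 a)
    · refine forall_congr' fun qd => forall_congr' fun _ => ?_
      have := step [] τ.root_mem qd.1 qd.2 (fun l => l = [BAct.accept])
      constructor
      · rintro ⟨c, h1, h2⟩
        obtain ⟨⟨t, a⟩, h3, h4, h5⟩ := this.1 ⟨(c, _), h1, h2, rfl⟩
        simp only at h5
        subst h5
        exact ⟨t, h3, h4⟩
      · rintro ⟨c, h1, h2⟩
        obtain ⟨⟨t, a⟩, h3, h4, h5⟩ := this.2 ⟨(c, _), h1, h2, rfl⟩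
        simp only at h5
        subst h5
        exact ⟨t, h3, h4⟩

/-- **Normal form for BUDTA**: every BUDTA in semigroup form can be effectively
transformed into an equivalent one in normal form. -/
theorem budta_normal_form (A D : Type) [Fintype A] [Infinite D] :
    ∃ F : SGBUDTA A → SGBUDTA A,
      ∀ M : SGBUDTA A,
        NormalForm (F M) ∧ ∀ τ : DataTree A D, SAccepts (F M) τ ↔ SAccepts M τ := by
  choose F hF using exists_nf A D
  exact ⟨F, hF⟩

end SGB
end

section
/- For every BUDTA with ε-transitions (BUDTA^ε) one can effectively construct a BUDTA that accepts exactly the same data trees. -/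
namespace BUDA

/-- Positions in an unranked tree: finite sequences of natural numbers. -/
abbrev Pos : Type := List ℕ

/-- A data tree over a label alphabet `A` and data domain `D`. -/
structure DataTree (A D : Type) where
  pos : Finset Pos
  label : Pos → A
  data : Pos → D
  root_mem : ([] : Pos) ∈ pos
  parent_closed : ∀ (x : Pos) (i : ℕ), x ++ [i] ∈ pos → x ∈ pos
  sibling_closed : ∀ (x : Pos) (i : ℕ), x ++ [i + 1] ∈ pos → x ++ [i] ∈ pos

/-- `x` is a leaf of `τ`. -/
def IsLeaf {A D : Type} (τ : DataTree A D) (x : Pos) : Prop :=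
  ∀ i : ℕ, x ++ [i] ∉ τ.pos

/-- `p` is a downward path of `τ` starting at `x`: a nonempty sequence of
positions of `τ`, starting at `x`, in which each step goes from a node to one
of its children. -/
def IsDownPath {A D : Type} (τ : DataTree A D) (x : Pos) (p : List Pos) : Prop :=
  p ≠ [] ∧ p.head? = some x ∧ (∀ y ∈ p, y ∈ τ.pos) ∧
    List.Chain' (fun y z => ∃ i : ℕ, z = y ++ [i]) p

/-- The data values occurring in the subtree rooted at `x`. -/
def subtreeData {A D : Type} (τ : DataTree A D) (x : Pos) : Set D :=
  {d | ∃ y ∈ τ.pos, x <+: y ∧ τ.data y = d}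

/-- Basic tests of a BUDTA, over alphabet `A`, internal alphabet `B`, states `Q`. -/
inductive BTest (A B Q : Type) : Type where
  | state : Q → BTest A B Q                                 -- p
  | eq : BTest A B Q                                        -- eq
  | deq : RegularExpression (A × B) → BTest A B Q           -- ⟨e⟩^=
  | dneq : RegularExpression (A × B) → BTest A B Q          -- ⟨e⟩^≠
  | root : BTest A B Q
  | leaf : BTest A B Q
  | lab : A → BTest A B Q                                   -- a
  | ilab : B → BTest A B Q                                  -- b

/-- Basic actions of a BUDTA. -/
inductive BAct (Q : Type) : Type where
  | accept : BAct Q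
  | keep : Q → BAct Q
  | store : Q → BAct Q
  | guess : Q → BAct Q
  | univ : Q → BAct Q

/-- A transition: a conjunction of possibly negated basic tests (the Boolean
flag `true` marks a negated test) together with a conjunction of basic actions. -/
abbrev Trans (A B Q : Type) : Type := List (Bool × BTest A B Q) × List (BAct Q)

/-- Satisfaction of a basic test by the thread `(q, d)` at position `x` of the
tree `τ` with internal labeling `bl`. -/
def basicHolds {A B Q D : Type} (τ : DataTree A D) (bl : Pos → B) (x : Pos)
    (q : Q) (d : D) : BTest A B Q → Prop
  | .state p => q = p
  | .eq => τ.data x = d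
  | .deq e => ∃ p y, IsDownPath τ x p ∧ p.getLast? = some y ∧
      (p.map fun z => (τ.label z, bl z)) ∈ e.matches' ∧ τ.data y = d
  | .dneq e => ∃ p y, IsDownPath τ x p ∧ p.getLast? = some y ∧
      (p.map fun z => (τ.label z, bl z)) ∈ e.matches' ∧ τ.data y ≠ d
  | .root => x = ([] : Pos)
  | .leaf => IsLeaf τ x
  | .lab a => τ.label x = a
  | .ilab b => bl x = b

/-- Satisfaction of a conjunction of possibly negated basic tests. -/
def testHolds {A B Q D : Type} (τ : DataTree A D) (bl : Pos → B) (x : Pos)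
    (q : Q) (d : D) (t : List (Bool × BTest A B Q)) : Prop :=
  ∀ nt ∈ t, (basicHolds τ bl x q d nt.2 ↔ nt.1 = false)

/-- The constraint imposed on the configuration `ρ y` of the parent `y` of `x`
by a basic action executed at `x` by a thread with register value `d`. -/
def actOK {A Q D : Type} (τ : DataTree A D) (x y : Pos)
    (ρ : Pos → Set (Q × D)) (d : D) : BAct Q → Prop
  | .accept => True
  | .keep p => (p, d) ∈ ρ y
  | .store p => (p, τ.data x) ∈ ρ y
  | .guess p => ∃ e : D, (p, e) ∈ ρ y
  | .univ p => ∀ e ∈ subtreeData τ x, (p, e) ∈ ρ y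

/-- `ρ` is a run of the automaton with initial state `q0` and transitions `δ`
on the tree `τ` with internal labeling `bl`. -/
def IsRun {A B Q D : Type} (q0 : Q) (δ : List (Trans A B Q))
    (τ : DataTree A D) (bl : Pos → B) (ρ : Pos → Set (Q × D)) : Prop :=
  (∀ x ∈ τ.pos, (ρ x).Finite) ∧
  (∀ x ∈ τ.pos, IsLeaf τ x → ∃ e : D, ρ x = {(q0, e)}) ∧
  (∀ (y : Pos) (i : ℕ), y ++ [i] ∈ τ.pos → ∀ qd ∈ ρ (y ++ [i]),
    ∃ tr ∈ δ, testHolds τ bl (y ++ [i]) qd.1 qd.2 tr.1 ∧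
      ∀ a ∈ tr.2, actOK τ (y ++ [i]) y ρ qd.2 a)

/-- `ρ` is an accepting run: a run in which every root thread satisfies the
test of some transition whose action is `accept`. -/
def IsAcceptingRun {A B Q D : Type} (q0 : Q) (δ : List (Trans A B Q))
    (τ : DataTree A D) (bl : Pos → B) (ρ : Pos → Set (Q × D)) : Prop :=
  IsRun q0 δ τ bl ρ ∧
  ∀ qd ∈ ρ ([] : Pos), ∃ t, (t, [BAct.accept]) ∈ δ ∧ testHolds τ bl [] qd.1 qd.2 t

/-- A Bottom-Up Data Automaton over the alphabet `A`: a finite internal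
alphabet `B`, a finite set of states `Q`, an initial state and a finite set of
transitions. -/
structure BUDTA (A : Type) : Type 1 where
  B : Type
  Bfin : Finite B
  Q : Type
  Qfin : Finite Q
  q0 : Q
  δ : List (Trans A B Q)

/-- The automaton `M` accepts the data tree `τ`: for some internal labeling
there is an accepting run. -/
def Accepts {A D : Type} (M : BUDTA A) (τ : DataTree A D) : Prop :=
  ∃ bl : Pos → M.B, ∃ ρ : Pos → Set (M.Q × D), IsAcceptingRun M.q0 M.δ τ bl ρ

/-- The state a basic action switches to (`none` for `accept`). -/
def actTarget {Q : Type} : BAct Q → Option Q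
  | .accept => none
  | .keep p => some p
  | .store p => some p
  | .guess p => some p
  | .univ p => some p

/-- A BUDTA with ε-transitions: the states are partitioned into ε-states and
moving states (`isEps`), `Q` carries a strict partial order `lt`, and every
basic action targeting an ε-state `p` occurs in a transition whose test
contains a (positive) state test `q` with `q < p`. -/
structure EpsBUDTA (A : Type) : Type 1 where
  B : Type
  Bfin : Finite B
  Q : Type
  Qfin : Finite Q
  isEps : Q → Bool
  lt : Q → Q → Prop
  lt_irrefl : ∀ q, ¬ lt q q
  lt_trans : ∀ p q r, lt p q → lt q r → lt p r
  q0 : Q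
  δ : List (Trans A B Q)
  eps_guarded : ∀ tr ∈ δ, ∀ a ∈ tr.2, ∀ p, actTarget a = some p → isEps p = true →
    ∃ nt ∈ tr.1, nt.1 = false ∧ ∃ q, nt.2 = BTest.state q ∧ lt q p

/-- The constraint imposed by a basic action in an ε-automaton: the new threads
are contributed to the current node `x` if the target state is an ε-state, and
to the parent node `y` otherwise. -/
def epsActOK {A Q D : Type} (isEps : Q → Bool) (τ : DataTree A D) (x y : Pos)
    (ρ : Pos → Set (Q × D)) (d : D) : BAct Q → Prop
  | .accept => True
  | .keep p => (p, d) ∈ ρ (if isEps p then x else y)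
  | .store p => (p, τ.data x) ∈ ρ (if isEps p then x else y)
  | .guess p => ∃ e : D, (p, e) ∈ ρ (if isEps p then x else y)
  | .univ p => ∀ e ∈ subtreeData τ x, (p, e) ∈ ρ (if isEps p then x else y)

/-- A run of a BUDTA with ε-transitions. -/
def EpsIsRun {A B Q D : Type} (isEps : Q → Bool) (q0 : Q)
    (δ : List (Trans A B Q)) (τ : DataTree A D) (bl : Pos → B)
    (ρ : Pos → Set (Q × D)) : Prop :=
  (∀ x ∈ τ.pos, (ρ x).Finite) ∧
  (∀ x ∈ τ.pos, IsLeaf τ x → ∃ e : D, ρ x = {(q0, e)}) ∧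
  (∀ (y : Pos) (i : ℕ), y ++ [i] ∈ τ.pos → ∀ qd ∈ ρ (y ++ [i]),
    ∃ tr ∈ δ, testHolds τ bl (y ++ [i]) qd.1 qd.2 tr.1 ∧
      ∀ a ∈ tr.2, epsActOK isEps τ (y ++ [i]) y ρ qd.2 a)

def EpsIsAcceptingRun {A B Q D : Type} (isEps : Q → Bool) (q0 : Q)
    (δ : List (Trans A B Q)) (τ : DataTree A D) (bl : Pos → B)
    (ρ : Pos → Set (Q × D)) : Prop :=
  EpsIsRun isEps q0 δ τ bl ρ ∧
  ∀ qd ∈ ρ ([] : Pos), ∃ t, (t, [BAct.accept]) ∈ δ ∧ testHolds τ bl [] qd.1 qd.2 t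

def EpsAccepts {A D : Type} (M : EpsBUDTA A) (τ : DataTree A D) : Prop :=
  ∃ bl : Pos → M.B, ∃ ρ : Pos → Set (M.Q × D),
    EpsIsAcceptingRun M.isEps M.q0 M.δ τ bl ρ

/-! ### Auxiliary construction -/

/-- States of the simulating automaton. -/
inductive St (Q J : Type) : Type where
  | start : St Q J
  | chk : J → St Q J
  | run : Q → St Q J
  | st : Q → St Q J

/-- `(G, T, U)`: states present with some datum, with the current datum,
with all data of the subtree. -/
abbrev Info (Q : Type) : Type := Set Q × Set Q × Set Q

instance St.finite {Q J : Type} [Finite Q] [Finite J] : Finite (St Q J) := by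
  let g : Option (J ⊕ (Q ⊕ Q)) → St Q J := fun o => match o with
    | none => .start
    | some (.inl j) => .chk j
    | some (.inr (.inl q)) => .run q
    | some (.inr (.inr q)) => .st q
  refine Finite.of_surjective g ?_
  rintro (_ | j | q | q)
  · exact ⟨none, rfl⟩
  · exact ⟨some (.inl j), rfl⟩
  · exact ⟨some (.inr (.inl q)), rfl⟩
  · exact ⟨some (.inr (.inr q)), rfl⟩

/-- The list of all elements of a finite set. -/
noncomputable def elems {α : Type} [Finite α] (s : Set α) : List α :=
  (Set.toFinite s).toFinset.toList

theorem mem_elems {α : Type} [Finite α] (s : Set α) (a : α) : a ∈ elems s ↔ a ∈ s := by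
  simp [elems]

/-- Sum of characters. -/
def charSum {C K : Type} (g : K → C) : List K → RegularExpression C
  | [] => 0
  | k :: l => RegularExpression.char (g k) + charSum g l

theorem mem_charSum {C K : Type} (g : K → C) (l : List K) (w : List C) :
    w ∈ (charSum g l).matches' ↔ ∃ k ∈ l, w = [g k] := by
  induction l with
  | nil => simp [charSum, Language.notMem_zero]
  | cons k l ih =>
    simp only [charSum, RegularExpression.matches'_add, Language.mem_add, ih,
      RegularExpression.matches'_char, List.mem_cons, exists_eq_or_imp]
    rfl

/-- Preimage of a regular expression under the projection of internal labels. -/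
noncomputable def pull {A B J : Type} [Finite J] :
    RegularExpression (A × B) → RegularExpression (A × (B × J))
  | .zero => 0
  | .epsilon => 1
  | .char c => charSum (fun j : J => (c.1, (c.2, j))) (elems Set.univ)
  | .plus e f => pull e + pull f
  | .comp e f => pull e * pull f
  | .star e => RegularExpression.star (pull e)

theorem mem_pull {A B J : Type} [Finite J] (e : RegularExpression (A × B)) :
    ∀ w : List (A × (B × J)),
      w ∈ (pull e).matches' ↔ (w.map fun c => (c.1, c.2.1)) ∈ e.matches' := by
  induction e with
  | zero => intro w; exact Iff.rfl
  | epsilon =>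
    intro w
    change w ∈ (1 : Language _) ↔ _ ∈ (1 : Language _)
    simp [Language.mem_one]
  | char c =>
    intro w
    simp only [pull, mem_charSum, mem_elems, Set.mem_univ, true_and]
    change _ ↔ _ = [c]
    constructor
    · rintro ⟨j, rfl⟩; rfl
    · intro h
      rw [List.map_eq_singleton_iff] at h
      obtain ⟨⟨a, b, j⟩, rfl, rfl⟩ := h
      exact ⟨j, rfl⟩
  | plus e f he hf =>
    intro w
    change w ∈ (pull e).matches' + (pull f).matches' ↔ _ ∈ e.matches' + f.matches'
    simp only [Language.mem_add, he, hf]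
  | comp e f he hf =>
    intro w
    change w ∈ (pull e).matches' * (pull f).matches' ↔ _ ∈ e.matches' * f.matches'
    simp only [Language.mem_mul]
    constructor
    · rintro ⟨u, hu, v, hv, rfl⟩
      exact ⟨_, (he u).1 hu, _, (hf v).1 hv, by simp⟩
    · rintro ⟨u, hu, v, hv, h⟩
      obtain ⟨u', v', rfl, rfl, rfl⟩ := List.map_eq_append_iff.1 h.symm
      exact ⟨u', (he _).2 hu, v', (hf _).2 hv, rfl⟩
  | star e he =>
    intro w
    change w ∈ KStar.kstar (pull e).matches' ↔ _ ∈ KStar.kstar e.matches'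
    simp only [Language.mem_kstar]
    constructor
    · rintro ⟨L, rfl, hL⟩
      refine ⟨L.map (List.map fun c => (c.1, c.2.1)), by rw [List.map_flatten], ?_⟩
      intro y hy
      obtain ⟨z, hz, rfl⟩ := List.mem_map.1 hy
      exact (he z).1 (hL z hz)
    · rintro ⟨L, h, hL⟩
      induction L generalizing w with
      | nil =>
        refine ⟨[], ?_, by simp⟩
        simpa using h
      | cons l L ih =>
        rw [List.flatten_cons] at h
        obtain ⟨u', v', rfl, rfl, h3⟩ := List.map_eq_append_iff.1 h
        obtain ⟨L', hL', hL''⟩ := ih v' h3 (fun y hy => hL y (List.mem_cons_of_mem _ hy))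
        refine ⟨u' :: L', by simp [hL'], ?_⟩
        intro y hy
        rcases List.mem_cons.1 hy with rfl | hy
        · exact (he _).2 (hL _ List.mem_cons_self)
        · exact hL'' y hy

section Constr

variable {A B Q D : Type}

/-- The part of a test decided by the state and internal label. -/
def pureOne (b : B) (q : Q) (nt : Bool × BTest A B Q) : Prop :=
  match nt.2 with
  | .state p => (q = p ↔ nt.1 = false)
  | .ilab c => (b = c ↔ nt.1 = false)
  | _ => True

/-- The remaining part of a test. -/
noncomputable def restOne {J S : Type} [Finite J] (nt : Bool × BTest A B Q) :
    List (Bool × BTest A (B × J) S) :=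
  match nt.2 with
  | .state _ => []
  | .ilab _ => []
  | .eq => [(nt.1, .eq)]
  | .deq e => [(nt.1, .deq (pull e))]
  | .dneq e => [(nt.1, .dneq (pull e))]
  | .root => [(nt.1, .root)]
  | .leaf => [(nt.1, .leaf)]
  | .lab a => [(nt.1, .lab a)]

theorem pure_rest {J S : Type} [Finite J] (τ : DataTree A D) (bl : Pos → B × J) (x : Pos)
    (q : Q) (s : S) (d : D) (t : List (Bool × BTest A B Q)) :
    ((∀ nt ∈ t, pureOne (bl x).1 q nt) ∧ testHolds τ bl x s d (t.flatMap restOne)) ↔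
      testHolds τ (fun z => (bl z).1) x q d t := by
  have key : ∀ nt : Bool × BTest A B Q,
      (pureOne (bl x).1 q nt ∧ testHolds τ bl x s d (restOne nt)) ↔
        (basicHolds τ (fun z => (bl z).1) x q d nt.2 ↔ nt.1 = false) := by
    rintro ⟨n, t⟩
    cases t <;>
      simp [pureOne, restOne, testHolds, basicHolds, mem_pull, Function.comp_def]
  constructor
  · rintro ⟨h1, h2⟩ nt hnt
    refine (key nt).1 ⟨h1 nt hnt, fun m hm => h2 m ?_⟩
    exact List.mem_flatMap.2 ⟨nt, hnt, hm⟩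
  · intro h
    refine ⟨fun nt hnt => ((key nt).2 (h nt hnt)).1, fun m hm => ?_⟩
    obtain ⟨nt, hnt, hm⟩ := List.mem_flatMap.1 hm
    exact ((key nt).2 (h nt hnt)).2 m hm

/-- The moving part of an action. -/
def mvAct {J : Type} (isEps : Q → Bool) : BAct Q → List (BAct (St Q J))
  | .accept => []
  | .keep p => if isEps p then [] else [.keep (.run p)]
  | .store p => if isEps p then [] else [.store (.run p)]
  | .guess p => if isEps p then [] else [.guess (.run p)]
  | .univ p => if isEps p then [] else [.univ (.run p)]

/-- The condition replacing the ε-part of an action. -/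
def epsCond (isEps : Q → Bool) (P : Set Q) (J : Info Q) : BAct Q → Prop
  | .accept => True
  | .keep p => isEps p = true → p ∈ P
  | .store p => isEps p = true → p ∈ J.2.1
  | .guess p => isEps p = true → p ∈ J.1
  | .univ p => isEps p = true → p ∈ J.2.1 ∧ p ∈ J.2.2

/-- Support actions: announce `J` to the parent. -/
noncomputable def sup [Finite Q] (J : Info Q) : List (BAct (St Q (Info Q))) :=
  BAct.guess (.chk J) :: ((elems J.1).map (fun p => BAct.guess (.run p)) ++
    ((elems J.2.1).map (fun p => BAct.guess (.st p)) ++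
      (elems J.2.2).map (fun p => BAct.univ (.run p))))

/-- Transitions of the new automaton. -/
abbrev NT (A B Q : Type) : Type := Trans A (B × Info Q) (St Q (Info Q))

/-- Head of a test: state and internal label. -/
def hd (s : St Q (Info Q)) (b : B × Info Q) :
    List (Bool × BTest A (B × Info Q) (St Q (Info Q))) :=
  [(false, .state s), (false, .ilab b)]

variable (isEps : Q → Bool) (q0 : Q) (δ : List (Trans A B Q))

/-- Domain of a partial choice of transitions. -/
def dom (f : Q → Option (Fin δ.length)) : Set Q := {q | ∃ i, f q = some i}

/-- Tests of a bundle. -/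
noncomputable def bTests [Finite Q] (f : Q → Option (Fin δ.length)) :
    List (Bool × BTest A (B × Info Q) (St Q (Info Q))) :=
  (elems (Set.univ : Set Q)).flatMap fun q => (f q).toList.flatMap fun i =>
    (δ.get i).1.flatMap restOne

/-- Actions of a bundle. -/
noncomputable def bActs [Finite Q] (f : Q → Option (Fin δ.length)) :
    List (BAct (St Q (Info Q))) :=
  (elems (Set.univ : Set Q)).flatMap fun q => (f q).toList.flatMap fun i =>
    (δ.get i).2.flatMap (mvAct isEps)

/-- The bundle is consistent. -/
def bOK (f : Q → Option (Fin δ.length)) (b : B × Info Q) : Prop :=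
  ∀ p i, f p = some i → (∀ nt ∈ (δ.get i).1, pureOne b.1 p nt) ∧
    ∀ a ∈ (δ.get i).2, epsCond isEps (dom δ f) b.2 a

theorem mem_bTests [Finite Q] (f : Q → Option (Fin δ.length)) (m) :
    m ∈ bTests δ f ↔ ∃ q i, f q = some i ∧ m ∈ (δ.get i).1.flatMap restOne := by
  simp only [bTests, List.mem_flatMap, mem_elems, Set.mem_univ, true_and, Option.mem_toList]

theorem mem_bActs [Finite Q] (f : Q → Option (Fin δ.length)) (m) :
    m ∈ bActs isEps δ f ↔ ∃ q i, f q = some i ∧ ∃ a ∈ (δ.get i).2, m ∈ mvAct isEps a := by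
  simp only [bActs, List.mem_flatMap, mem_elems, Set.mem_univ, true_and, Option.mem_toList]

/-- ordinary bundle transitions -/
def T1 [Finite Q] : Set (NT A B Q) := {tr | ∃ (q : Q) (f : Q → Option (Fin δ.length))
  (b : B × Info Q), q ∈ dom δ f ∧ bOK isEps δ f b ∧
    tr = (hd (.run q) b ++ bTests δ f, bActs isEps δ f)}

/-- stored bundle transitions -/
def T1s [Finite Q] : Set (NT A B Q) := {tr | ∃ (q : Q) (f : Q → Option (Fin δ.length))
  (b : B × Info Q), q ∈ dom δ f ∧ bOK isEps δ f b ∧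
    tr = (hd (.st q) b ++ ((false, .eq) :: bTests δ f), bActs isEps δ f)}

/-- support transitions -/
def T2 (A B Q : Type) [Finite Q] : Set (NT A B Q) := {tr | ∃ (b : B × Info Q) (J : Info Q),
  tr = (hd (.chk b.2) b, sup J)}

/-- initial transitions -/
def T3 [Finite Q] : Set (NT A B Q) := {tr | ∃ (i : Fin δ.length) (b : B × Info Q) (J : Info Q),
  (∀ nt ∈ (δ.get i).1, pureOne b.1 q0 nt) ∧
  (∀ a ∈ (δ.get i).2, ∀ p, actTarget a = some p → isEps p = false) ∧
    tr = (hd .start b ++ (δ.get i).1.flatMap restOne,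
      (δ.get i).2.flatMap (mvAct isEps) ++ sup J)}

/-- Underlying state. -/
def base : St Q (Info Q) → Option Q
  | .start => some q0
  | .chk _ => none
  | .run q => some q
  | .st q => some q

/-- accepting transitions -/
def T4 [Finite Q] : Set (NT A B Q) := {tr | ∃ (i : Fin δ.length) (b : B × Info Q)
  (s : St Q (Info Q)) (q : Q), base q0 s = some q ∧ (δ.get i).2 = [BAct.accept] ∧
  (∀ nt ∈ (δ.get i).1, pureOne b.1 q nt) ∧
    tr = (hd s b ++ ((false, .root) :: (δ.get i).1.flatMap restOne), [BAct.accept])}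

/-- accepting support transitions -/
def T5 (A B Q : Type) : Set (NT A B Q) := {tr | ∃ (b : B × Info Q),
  tr = (hd (.chk b.2) b ++ [(false, .root)], [BAct.accept])}

/-- all transitions -/
def TT [Finite Q] : Set (NT A B Q) :=
  T1 isEps δ ∪ T1s isEps δ ∪ T2 A B Q ∪ T3 isEps q0 δ ∪ T4 q0 δ ∪ T5 A B Q

theorem TT_finite [Finite Q] [Finite B] : (TT isEps q0 δ).Finite := by
  refine (((((Set.Finite.union ?_ ?_).union ?_).union ?_).union ?_).union ?_)
  · refine (Set.finite_range (fun z : Q × (Q → Option (Fin δ.length)) × (B × Info Q) =>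
      ((hd (.run z.1) z.2.2 ++ bTests δ z.2.1, bActs isEps δ z.2.1) : NT A B Q))).subset ?_
    rintro tr ⟨q, f, b, -, -, rfl⟩
    exact ⟨(q, f, b), rfl⟩
  · refine (Set.finite_range (fun z : Q × (Q → Option (Fin δ.length)) × (B × Info Q) =>
      ((hd (.st z.1) z.2.2 ++ ((false, .eq) :: bTests δ z.2.1),
        bActs isEps δ z.2.1) : NT A B Q))).subset ?_
    rintro tr ⟨q, f, b, -, -, rfl⟩
    exact ⟨(q, f, b), rfl⟩
  · refine (Set.finite_range (fun z : (B × Info Q) × Info Q =>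
      ((hd (.chk z.1.2) z.1, sup z.2) : NT A B Q))).subset ?_
    rintro tr ⟨b, J, rfl⟩
    exact ⟨(b, J), rfl⟩
  · refine (Set.finite_range (fun z : Fin δ.length × (B × Info Q) × Info Q =>
      ((hd .start z.2.1 ++ (δ.get z.1).1.flatMap restOne,
      (δ.get z.1).2.flatMap (mvAct isEps) ++ sup z.2.2) : NT A B Q))).subset ?_
    rintro tr ⟨i, b, J, -, -, rfl⟩
    exact ⟨(i, b, J), rfl⟩
  · refine (Set.finite_range (fun z : Fin δ.length × (B × Info Q) × St Q (Info Q) =>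
      ((hd z.2.2 z.2.1 ++ ((false, .root) :: (δ.get z.1).1.flatMap restOne),
        [BAct.accept]) : NT A B Q))).subset ?_
    rintro tr ⟨i, b, s, q, -, -, -, rfl⟩
    exact ⟨(i, b, s), rfl⟩
  · refine (Set.finite_range (fun z : (B × Info Q) =>
      ((hd (.chk z.2) z ++ [(false, .root)], [BAct.accept]) : NT A B Q))).subset ?_
    rintro tr ⟨b, rfl⟩
    exact ⟨b, rfl⟩

theorem testHolds_append {A B Q D : Type} (τ : DataTree A D) (bl : Pos → B) (x : Pos)
    (q : Q) (d : D) (t t' : List (Bool × BTest A B Q)) :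
    testHolds τ bl x q d (t ++ t') ↔ testHolds τ bl x q d t ∧ testHolds τ bl x q d t' := by
  simp only [testHolds, List.mem_append, or_imp, forall_and]

theorem testHolds_cons {A B Q D : Type} (τ : DataTree A D) (bl : Pos → B) (x : Pos)
    (q : Q) (d : D) (m) (t : List (Bool × BTest A B Q)) :
    testHolds τ bl x q d (m :: t) ↔
      (basicHolds τ bl x q d m.2 ↔ m.1 = false) ∧ testHolds τ bl x q d t := by
  simp only [testHolds, List.mem_cons, forall_eq_or_imp]

theorem testHolds_hd (τ : DataTree A D) (bl : Pos → B × Info Q) (x : Pos)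
    (s s' : St Q (Info Q)) (b) (d : D) :
    testHolds τ bl x s d (hd s' b) ↔ s = s' ∧ bl x = b := by
  simp [testHolds, hd, basicHolds]

theorem bundle_iff [Finite Q] (τ : DataTree A D) (bl : Pos → B × Info Q) (x : Pos)
    (s : St Q (Info Q)) (d : D) (f : Q → Option (Fin δ.length)) :
    (bOK isEps δ f (bl x) ∧ testHolds τ bl x s d (bTests δ f)) ↔
      ∀ p i, f p = some i → testHolds τ (fun z => (bl z).1) x p d (δ.get i).1 ∧
        ∀ a ∈ (δ.get i).2, epsCond isEps (dom δ f) (bl x).2 a := by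
  constructor
  · rintro ⟨h1, h2⟩ p i hf
    refine ⟨(pure_rest τ bl x p s d _).1 ⟨(h1 p i hf).1, fun m hm => ?_⟩, (h1 p i hf).2⟩
    exact h2 m ((mem_bTests δ f m).2 ⟨p, i, hf, hm⟩)
  · intro h
    refine ⟨fun p i hf => ⟨((pure_rest τ bl x p s d _).2 (h p i hf).1).1, (h p i hf).2⟩, ?_⟩
    intro m hm
    obtain ⟨p, i, hf, hm⟩ := (mem_bTests δ f m).1 hm
    exact ((pure_rest τ bl x p s d _).2 (h p i hf).1).2 m hm

/-- Bottom-up induction on a data tree. -/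
theorem tree_induct (τ : DataTree A D) (C : Pos → Prop)
    (h : ∀ x ∈ τ.pos, (∀ i, x ++ [i] ∈ τ.pos → C (x ++ [i])) → C x) :
    ∀ x ∈ τ.pos, C x := by
  have key : ∀ n, ∀ x ∈ τ.pos, τ.pos.sup List.length - x.length ≤ n → C x := by
    intro n
    induction n with
    | zero =>
      intro x hx hn
      refine h x hx fun i hi => ?_
      have := Finset.le_sup (f := List.length) hi
      simp only [List.length_append, List.length_singleton] at this
      omega
    | succ n ih =>
      intro x hx hn
      refine h x hx fun i hi => ih _ hi ?_
      simp only [List.length_append, List.length_singleton]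
      omega
  exact fun x hx => key _ x hx le_rfl

theorem prefix_mem (τ : DataTree A D) (x z : Pos) (h : x ++ z ∈ τ.pos) : x ∈ τ.pos := by
  induction z using List.reverseRecOn with
  | nil => simpa using h
  | append_singleton z i ih =>
    rw [← List.append_assoc] at h
    exact ih (τ.parent_closed _ _ h)

theorem subtreeData_cases (τ : DataTree A D) (x : Pos) (e : D) (h : e ∈ subtreeData τ x) :
    e = τ.data x ∨ ∃ i, x ++ [i] ∈ τ.pos ∧ e ∈ subtreeData τ (x ++ [i]) := by
  obtain ⟨y, hy, ⟨z, rfl⟩, rfl⟩ := h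
  cases z with
  | nil => left; simp
  | cons i z =>
    right
    have : x ++ i :: z = (x ++ [i]) ++ z := by simp
    rw [this] at hy ⊢
    exact ⟨i, prefix_mem τ _ _ hy, _, hy, ⟨z, rfl⟩, rfl⟩

theorem subtreeData_mono (τ : DataTree A D) (x : Pos) (i : ℕ) :
    subtreeData τ (x ++ [i]) ⊆ subtreeData τ x := by
  rintro e ⟨y, hy, hp, rfl⟩
  exact ⟨y, hy, (List.prefix_append x [i]).trans hp, rfl⟩

theorem data_mem_subtree (τ : DataTree A D) (x : Pos) (hx : x ∈ τ.pos) :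
    τ.data x ∈ subtreeData τ x := ⟨x, hx, List.prefix_rfl, rfl⟩

theorem toEps (τ : DataTree A D) (x y : Pos) (ρ : Pos → Set (Q × D))
    (ρ' : Pos → Set (St Q (Info Q) × D)) (d : D) (P : Set Q) (J : Info Q) (a : BAct Q)
    (hmv : ∀ a' ∈ mvAct isEps a, actOK τ x y ρ' d a')
    (hy : ∀ r e, (St.run r, e) ∈ ρ' y → (r, e) ∈ ρ y)
    (heps : epsCond isEps P J a)
    (hP : ∀ p ∈ P, (p, d) ∈ ρ x) (hS : ∀ p ∈ J.2.1, (p, τ.data x) ∈ ρ x)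
    (hG : ∀ p ∈ J.1, ∃ e, (p, e) ∈ ρ x)
    (hU : ∀ p ∈ J.2.1, p ∈ J.2.2 → ∀ e ∈ subtreeData τ x, (p, e) ∈ ρ x) :
    epsActOK isEps τ x y ρ d a := by
  cases a with
  | accept => trivial
  | keep p =>
    cases h : isEps p with
    | true => simpa [epsActOK, h] using hP p (heps h)
    | false =>
      have := hmv (.keep (.run p)) (by simp [mvAct, h])
      simpa [epsActOK, h] using hy _ _ this
  | store p =>
    cases h : isEps p with
    | true => simpa [epsActOK, h] using hS p (heps h)
    | false =>
      have := hmv (.store (.run p)) (by simp [mvAct, h])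
      simpa [epsActOK, h] using hy _ _ this
  | guess p =>
    cases h : isEps p with
    | true => simpa [epsActOK, h] using hG p (heps h)
    | false =>
      obtain ⟨e, he⟩ := hmv (.guess (.run p)) (by simp [mvAct, h])
      simpa [epsActOK, h] using ⟨e, hy _ _ he⟩
  | univ p =>
    cases h : isEps p with
    | true => simpa [epsActOK, h] using hU p (heps h).1 (heps h).2
    | false =>
      have := hmv (.univ (.run p)) (by simp [mvAct, h])
      simpa [epsActOK, h] using fun e he => hy _ _ (this e he)

theorem fromEps (τ : DataTree A D) (x y : Pos) (ρ : Pos → Set (Q × D))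
    (ρ' : Pos → Set (St Q (Info Q) × D)) (d : D) (a : BAct Q)
    (hy : ∀ r e, (r, e) ∈ ρ y → (St.run r, e) ∈ ρ' y)
    (h : epsActOK isEps τ x y ρ d a) :
    ∀ a' ∈ mvAct isEps a, actOK τ x y ρ' d a' := by
  intro a' ha'
  cases a with
  | accept => simp [mvAct] at ha'
  | keep p =>
    cases hp : isEps p with
    | true => simp [mvAct, hp] at ha'
    | false =>
      simp only [mvAct, hp, epsActOK] at ha' h
      obtain rfl : a' = _ := by simpa using ha'
      exact hy _ _ (by simpa using h)
  | store p =>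
    cases hp : isEps p with
    | true => simp [mvAct, hp] at ha'
    | false =>
      simp only [mvAct, hp, epsActOK] at ha' h
      obtain rfl : a' = _ := by simpa using ha'
      exact hy _ _ (by simpa using h)
  | guess p =>
    cases hp : isEps p with
    | true => simp [mvAct, hp] at ha'
    | false =>
      simp only [mvAct, hp, epsActOK] at ha' h
      obtain rfl : a' = _ := by simpa using ha'
      obtain ⟨e, he⟩ := h
      exact ⟨e, hy _ _ (by simpa using he)⟩
  | univ p =>
    cases hp : isEps p with
    | true => simp [mvAct, hp] at ha'
    | false =>
      simp only [mvAct, hp, epsActOK] at ha' h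
      obtain rfl : a' = _ := by simpa using ha'
      exact fun e he => hy _ _ (by simpa using h e he)

/-- Semantic content of a bundle. -/
def Sem (τ : DataTree A D) (bl : Pos → B × Info Q) (ρ' : Pos → Set (St Q (Info Q) × D))
    (x y : Pos) (d : D) (f : Q → Option (Fin δ.length)) : Prop :=
  ∀ p i, f p = some i → testHolds τ (fun z => (bl z).1) x p d (δ.get i).1 ∧
    ∀ a ∈ (δ.get i).2, epsCond isEps (dom δ f) (bl x).2 a ∧
      ∀ a' ∈ mvAct isEps a, actOK τ x y ρ' d a'

theorem sem_of [Finite Q] (τ : DataTree A D) (bl : Pos → B × Info Q)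
    (ρ' : Pos → Set (St Q (Info Q) × D)) (x y : Pos) (s : St Q (Info Q)) (d : D)
    (f : Q → Option (Fin δ.length)) (h1 : bOK isEps δ f (bl x))
    (h2 : testHolds τ bl x s d (bTests δ f))
    (h3 : ∀ a ∈ bActs isEps δ f, actOK τ x y ρ' d a) : Sem isEps δ τ bl ρ' x y d f := by
  intro p i hf
  have := (bundle_iff isEps δ τ bl x s d f).1 ⟨h1, h2⟩ p i hf
  exact ⟨this.1, fun a ha => ⟨this.2 a ha, fun a' ha' =>
    h3 a' ((mem_bActs isEps δ f a').2 ⟨p, i, hf, a, ha, ha'⟩)⟩⟩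

theorem of_sem [Finite Q] (τ : DataTree A D) (bl : Pos → B × Info Q)
    (ρ' : Pos → Set (St Q (Info Q) × D)) (x y : Pos) (s : St Q (Info Q)) (d : D)
    (f : Q → Option (Fin δ.length)) (h : Sem isEps δ τ bl ρ' x y d f) :
    bOK isEps δ f (bl x) ∧ testHolds τ bl x s d (bTests δ f) ∧
      ∀ a ∈ bActs isEps δ f, actOK τ x y ρ' d a := by
  have := (bundle_iff isEps δ τ bl x s d f).2 fun p i hf =>
    ⟨(h p i hf).1, fun a ha => ((h p i hf).2 a ha).1⟩
  refine ⟨this.1, this.2, fun a' ha' => ?_⟩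
  obtain ⟨p, i, hf, a, ha, ha'⟩ := (mem_bActs isEps δ f a').1 ha'
  exact ((h p i hf).2 a ha).2 a' ha'

theorem sup_ok [Finite Q] (τ : DataTree A D) (ρ' : Pos → Set (St Q (Info Q) × D)) (x y : Pos)
    (d : D) (J : Info Q) : (∀ a ∈ sup J, actOK τ x y ρ' d a) ↔
      (∃ e, (St.chk J, e) ∈ ρ' y) ∧ (∀ p ∈ J.1, ∃ e, (St.run p, e) ∈ ρ' y) ∧
      (∀ p ∈ J.2.1, ∃ e, (St.st p, e) ∈ ρ' y) ∧
      (∀ p ∈ J.2.2, ∀ e ∈ subtreeData τ x, (St.run p, e) ∈ ρ' y) := by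
  simp only [sup, List.mem_cons, List.mem_append, List.mem_map, mem_elems, or_imp, forall_and,
    forall_eq, forall_exists_index, and_imp, forall_apply_eq_imp_iff₂, actOK]

/-- What a nonroot transition says, by state of the thread. -/
theorem inv_trans [Finite Q] (τ : DataTree A D) (bl : Pos → B × Info Q)
    (ρ' : Pos → Set (St Q (Info Q) × D)) (x y : Pos) (hx : x ≠ []) (s : St Q (Info Q)) (d : D)
    (tr : NT A B Q) (htr : tr ∈ TT isEps q0 δ) (ht : testHolds τ bl x s d tr.1)
    (ha : ∀ a ∈ tr.2, actOK τ x y ρ' d a) :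
    (∀ q, s = .run q → ∃ f, q ∈ dom δ f ∧ Sem isEps δ τ bl ρ' x y d f) ∧
    (∀ q, s = .st q → τ.data x = d ∧ ∃ f, q ∈ dom δ f ∧ Sem isEps δ τ bl ρ' x y d f) ∧
    (∀ I, s = .chk I → (bl x).2 = I ∧ ∃ J, ∀ a ∈ sup J, actOK τ x y ρ' d a) ∧
    (s = .start → (∃ J, ∀ a ∈ sup J, actOK τ x y ρ' d a) ∧ ∃ tr' ∈ δ,
      testHolds τ (fun z => (bl z).1) x q0 d tr'.1 ∧
      (∀ a ∈ tr'.2, ∀ p, actTarget a = some p → isEps p = false) ∧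
      ∀ a ∈ tr'.2, ∀ a' ∈ mvAct isEps a, actOK τ x y ρ' d a') := by
  rcases htr with ((((⟨q, f, b, h1, h2, rfl⟩ | ⟨q, f, b, h1, h2, rfl⟩) | ⟨b, J, rfl⟩) |
    ⟨i, b, J, h1, h2, rfl⟩) | ⟨i, b, s', q, -, -, -, rfl⟩) | ⟨b, rfl⟩
  · simp only [testHolds_append, testHolds_hd] at ht
    obtain ⟨⟨rfl, rfl⟩, ht⟩ := ht
    refine ⟨?_, by simp, by simp, by simp⟩
    rintro _ ⟨⟩
    exact ⟨f, h1, sem_of isEps δ τ bl ρ' x y _ d f h2 ht ha⟩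
  · simp only [testHolds_append, testHolds_cons, testHolds_hd] at ht
    obtain ⟨⟨rfl, rfl⟩, hq, ht⟩ := ht
    refine ⟨by simp, ?_, by simp, by simp⟩
    rintro _ ⟨⟩
    exact ⟨hq.2 (by trivial), f, h1, sem_of isEps δ τ bl ρ' x y _ d f h2 ht ha⟩
  · simp only [testHolds_hd] at ht
    obtain ⟨rfl, rfl⟩ := ht
    refine ⟨by simp, by simp, ?_, by simp⟩
    rintro _ ⟨⟩
    exact ⟨rfl, J, ha⟩
  · simp only [testHolds_append, testHolds_hd] at ht
    obtain ⟨⟨rfl, rfl⟩, ht⟩ := ht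
    refine ⟨by simp, by simp, by simp, ?_⟩
    intro _
    refine ⟨⟨J, fun a h => ha a (List.mem_append_right _ h)⟩, _, List.get_mem δ i,
      (pure_rest τ bl x q0 _ d _).1 ⟨h1, ht⟩, h2, fun a h a' h' => ha a' ?_⟩
    exact List.mem_append_left _ (List.mem_flatMap.2 ⟨a, h, h'⟩)
  · simp only [testHolds_append, testHolds_cons] at ht
    exact absurd (ht.2.1.2 (by trivial)) hx
  · simp only [testHolds_append, testHolds_cons] at ht
    exact absurd (ht.2.1.2 (by trivial)) hx

theorem mvAct_ne_accept {J : Type} (a : BAct Q) :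
    (BAct.accept : BAct (St Q J)) ∉ mvAct isEps a := by
  cases a <;> simp only [mvAct] <;> (try split) <;> simp

theorem inv_accept [Finite Q] (τ : DataTree A D) (bl : Pos → B × Info Q)
    (x : Pos) (s : St Q (Info Q)) (d : D)
    (t) (htr : (t, [BAct.accept]) ∈ TT isEps q0 δ) (ht : testHolds τ bl x s d t) :
    (∀ I, s = .chk I → (bl x).2 = I) ∧
    (∀ q, base q0 s = some q → ∃ t', (t', [BAct.accept]) ∈ δ ∧
      testHolds τ (fun z => (bl z).1) x q d t') := by
  rcases htr with ((((⟨q, f, b, h1, h2, h⟩ | ⟨q, f, b, h1, h2, h⟩) | ⟨b, J, h⟩) |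
    ⟨i, b, J, h1, h2, h⟩) | ⟨i, b, s', q, h1, h2, h3, h⟩) | ⟨b, h⟩
  · exfalso
    have : BAct.accept ∈ bActs isEps δ f := by rw [← (Prod.mk.inj h).2]; simp
    obtain ⟨_, _, _, a, _, ha⟩ := (mem_bActs isEps δ f _).1 this
    exact mvAct_ne_accept isEps a ha
  · exfalso
    have : BAct.accept ∈ bActs isEps δ f := by rw [← (Prod.mk.inj h).2]; simp
    obtain ⟨_, _, _, a, _, ha⟩ := (mem_bActs isEps δ f _).1 this
    exact mvAct_ne_accept isEps a ha
  · exfalso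
    simp [sup] at h
  · exfalso
    have : BAct.guess (St.chk J) ∈ (δ.get i).2.flatMap (mvAct isEps) ++ sup J := by simp [sup]
    rw [← (Prod.mk.inj h).2] at this
    simp at this
  · obtain rfl := (Prod.mk.inj h).1
    simp only [testHolds_append, testHolds_cons, testHolds_hd] at ht
    obtain ⟨⟨rfl, rfl⟩, _, ht⟩ := ht
    constructor
    · rintro I rfl
      simp [base] at h1
    · intro q' hq'
      obtain rfl : q = q' := by simpa [h1] using hq'
      refine ⟨(δ.get i).1, ?_, (pure_rest τ bl x q _ d _).1 ⟨h3, ht⟩⟩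
      rw [← h2]
      exact List.get_mem δ i
  · obtain rfl := (Prod.mk.inj h).1
    simp only [testHolds_append, testHolds_hd] at ht
    obtain ⟨⟨rfl, rfl⟩, _⟩ := ht
    constructor
    · rintro I ⟨⟩; rfl
    · intro q hq
      simp [base] at hq

open Classical in
theorem dir1 [Finite Q] [Finite B] (δ' : List (NT A B Q))
    (hδ' : ∀ tr, tr ∈ δ' ↔ tr ∈ TT isEps q0 δ) (τ : DataTree A D) (bl : Pos → B × Info Q)
    (ρ' : Pos → Set (St Q (Info Q) × D)) (h : IsAcceptingRun .start δ' τ bl ρ') :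
    ∃ ρ, EpsIsAcceptingRun isEps q0 δ τ (fun z => (bl z).1) ρ := by
  obtain ⟨⟨hfin, hleaf, hrun⟩, hacc⟩ := h
  have hinv := fun y i hy s d hs =>
    have hc := (hrun y i hy (s, d) hs).choose_spec
    inv_trans isEps q0 δ τ bl ρ' (y ++ [i]) y (by simp) s d _ ((hδ' _).1 hc.1) hc.2.1 hc.2.2
  have hinva := fun s d hs =>
    have hc := (hacc (s, d) hs).choose_spec
    inv_accept isEps q0 δ τ bl [] s d _ ((hδ' _).1 hc.1) hc.2
  -- labels agree with check threads
  have hchk : ∀ x ∈ τ.pos, ∀ I d, (St.chk I, d) ∈ ρ' x → (bl x).2 = I := by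
    intro x hx I d hI
    rcases List.eq_nil_or_concat x with rfl | ⟨y, i, rfl⟩
    · exact (hinva _ _ hI).1 I rfl
    · simp only [List.concat_eq_append] at *
      exact ((hinv y i hx _ _ hI).2.2.1 I rfl).1
  have hex : ∀ x ∈ τ.pos, (∃ d, (St.start, d) ∈ ρ' x) ∨ ∃ I d, (St.chk I, d) ∈ ρ' x := by
    refine tree_induct τ _ ?_
    intro x hx ih
    by_cases hl : IsLeaf τ x
    · obtain ⟨e, he⟩ := hleaf x hx hl
      exact .inl ⟨e, by simp [he]⟩
    · simp only [IsLeaf, not_forall, not_not] at hl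
      obtain ⟨i, hi⟩ := hl
      right
      rcases ih i hi with ⟨d, hd⟩ | ⟨I, d, hd⟩
      · obtain ⟨J, hJ⟩ := ((hinv x i hi _ _ hd).2.2.2 rfl).1
        exact ⟨J, ((sup_ok τ ρ' _ _ _ J).1 hJ).1⟩
      · obtain ⟨J, hJ⟩ := ((hinv x i hi _ _ hd).2.2.1 I rfl).2
        exact ⟨J, ((sup_ok τ ρ' _ _ _ J).1 hJ).1⟩
  have hsup : ∀ x i, x ++ [i] ∈ τ.pos → ∃ d, ∀ a ∈ sup (bl x).2,
      actOK τ (x ++ [i]) x ρ' d a := by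
    intro x i hi
    have : ∃ d J, ∀ a ∈ sup J, actOK τ (x ++ [i]) x ρ' d a := by
      rcases hex _ hi with ⟨d, hd⟩ | ⟨I, d, hd⟩
      · exact ⟨d, ((hinv x i hi _ _ hd).2.2.2 rfl).1⟩
      · exact ⟨d, ((hinv x i hi _ _ hd).2.2.1 I rfl).2⟩
    obtain ⟨d, J, hJ⟩ := this
    obtain ⟨e, he⟩ := ((sup_ok τ ρ' _ _ _ J).1 hJ).1
    rw [hchk x (τ.parent_closed _ _ hi) J e he]
    exact ⟨d, hJ⟩
  let ρ : Pos → Set (Q × D) := fun x =>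
    if IsLeaf τ x then {qd | qd.1 = q0 ∧ (St.start, qd.2) ∈ ρ' x}
    else if x = [] then {qd | (St.run qd.1, qd.2) ∈ ρ' x}
    else {qd | (∃ s, (s, qd.2) ∈ ρ' x) ∧
      ∃ f, qd.1 ∈ dom δ f ∧ Sem isEps δ τ bl ρ' x x.dropLast qd.2 f}
  have hρy : ∀ y ∈ τ.pos, ¬ IsLeaf τ y → ∀ r e, (St.run r, e) ∈ ρ' y → (r, e) ∈ ρ y := by
    intro y hy hl r e hr
    simp only [ρ, if_neg hl]
    rcases List.eq_nil_or_concat y with rfl | ⟨z, i, rfl⟩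
    · simpa using hr
    · simp only [List.concat_eq_append] at *
      obtain ⟨f, hf⟩ := (hinv z i hy _ _ hr).1 r rfl
      rw [if_neg (by simp)]
      exact ⟨⟨_, hr⟩, f, by simpa using hf⟩
  refine ⟨ρ, ⟨?_, ?_, ?_⟩, ?_⟩
  · intro x hx
    have : ((Set.univ : Set Q) ×ˢ (Set.image Prod.snd (ρ' x))).Finite :=
      Set.finite_univ.prod ((hfin x hx).image _)
    refine this.subset ?_
    rintro ⟨q, d⟩ hq
    refine ⟨trivial, ?_⟩
    simp only [ρ] at hq
    split_ifs at hq
    · exact ⟨_, hq.2, rfl⟩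
    · exact ⟨_, hq, rfl⟩
    · obtain ⟨⟨s, hs⟩, -⟩ := hq
      exact ⟨_, hs, rfl⟩
  · intro x hx hl
    obtain ⟨e, he⟩ := hleaf x hx hl
    refine ⟨e, ?_⟩
    ext ⟨q, d⟩
    simp [ρ, if_pos hl, he]
  · rintro y i hx ⟨q, d⟩ hq
    have hy : y ∈ τ.pos := τ.parent_closed _ _ hx
    have hyl : ¬ IsLeaf τ y := fun h => h i hx
    by_cases hl : IsLeaf τ (y ++ [i])
    · simp only [ρ, if_pos hl] at hq
      obtain ⟨rfl, hq⟩ := hq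
      simp only at hq
      obtain ⟨tr, htr, ht, hne, ha⟩ := ((hinv y i hx _ _ hq).2.2.2 rfl).2
      refine ⟨tr, htr, ht, fun a haa => ?_⟩
      refine toEps isEps τ _ _ ρ ρ' d ∅ (∅, ∅, ∅) a (ha a haa) (hρy y hy hyl) ?_
        (by simp) (by simp) (by simp) (by simp)
      have := hne a haa
      cases a <;> simp_all [epsCond, actTarget]
    · have hq' := hq
      simp only [ρ, if_neg hl] at hq'
      rw [if_neg (by simp)] at hq'
      obtain ⟨⟨s, hs⟩, f, ⟨j, hj⟩, hf⟩ := hq'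
      simp only [List.dropLast_concat] at hf hs hj
      have hex' : ∃ k, y ++ [i] ++ [k] ∈ τ.pos := by
        simpa only [IsLeaf, not_forall, not_not] using hl
      have hS : ∀ p ∈ (bl (y ++ [i])).2.2.1, (p, τ.data (y ++ [i])) ∈ ρ (y ++ [i]) := by
        intro p hp
        obtain ⟨k, hk⟩ := hex'
        obtain ⟨d', hd'⟩ := hsup _ k hk
        obtain ⟨e, he⟩ := ((sup_ok τ ρ' _ _ _ _).1 hd').2.2.1 p hp
        obtain ⟨rfl, g, hg⟩ := (hinv y i hx _ _ he).2.1 p rfl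
        simp only [ρ, if_neg hl]
        rw [if_neg (by simp)]
        exact ⟨⟨_, he⟩, g, by simpa using hg⟩
      refine ⟨δ.get j, List.get_mem δ j, (hf q j hj).1, fun a haa => ?_⟩
      obtain ⟨h1, h2⟩ := (hf q j hj).2 a haa
      refine toEps isEps τ _ _ ρ ρ' d _ _ a h2 (hρy y hy hyl) h1 ?_ hS ?_ ?_
      · intro p hp
        simp only [ρ, if_neg hl]
        rw [if_neg (by simp)]
        exact ⟨⟨s, hs⟩, f, hp, by simpa using hf⟩
      · intro p hp
        obtain ⟨k, hk⟩ := hex'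
        obtain ⟨d', hd'⟩ := hsup _ k hk
        obtain ⟨e, he⟩ := ((sup_ok τ ρ' _ _ _ _).1 hd').2.1 p hp
        exact ⟨e, hρy _ hx hl _ _ he⟩
      · intro p hp hp' e he
        rcases subtreeData_cases τ _ e he with rfl | ⟨k, hk, he⟩
        · exact hS p hp
        · obtain ⟨d', hd'⟩ := hsup _ k hk
          exact hρy _ hx hl _ _ (((sup_ok τ ρ' _ _ _ _).1 hd').2.2.2 p hp' e he)
  · rintro ⟨q, d⟩ hq
    simp only [ρ] at hq
    split_ifs at hq
    · obtain ⟨rfl, hq⟩ := hq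
      exact (hinva _ _ hq).2 q rfl
    · exact (hinva _ _ hq).2 q rfl

open Classical in
theorem dir2 [Finite Q] [Finite B] [Nonempty D] (lt : Q → Q → Prop) (irr : ∀ q, ¬ lt q q)
    (guarded : ∀ tr ∈ δ, ∀ a ∈ tr.2, ∀ p, actTarget a = some p → isEps p = true →
      ∃ nt ∈ tr.1, nt.1 = false ∧ ∃ q, nt.2 = BTest.state q ∧ lt q p)
    (δ' : List (NT A B Q))
    (hδ' : ∀ tr, tr ∈ δ' ↔ tr ∈ TT isEps q0 δ) (τ : DataTree A D) (bl : Pos → B)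
    (ρ : Pos → Set (Q × D)) (h : EpsIsAcceptingRun isEps q0 δ τ bl ρ) :
    ∃ bl' ρ', IsAcceptingRun .start δ' τ bl' ρ' := by
  obtain ⟨⟨hfin, hleaf, hrun⟩, hacc⟩ := h
  obtain ⟨d0⟩ := ‹Nonempty D›
  let info : Pos → Info Q := fun x => ({p | ∃ e, (p, e) ∈ ρ x}, {p | (p, τ.data x) ∈ ρ x},
    {p | ∀ e ∈ subtreeData τ x, (p, e) ∈ ρ x})
  let bl' : Pos → B × Info Q := fun x => (bl x, info x)
  let R : Pos → Set (St Q (Info Q) × D) := fun x =>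
    (Set.image (fun qd : Q × D => (St.run qd.1, qd.2)) (ρ x)) ∪
    ((Set.image (fun qd : Q × D => (St.st qd.1, qd.2)) {qd ∈ ρ x | qd.2 = τ.data x}) ∪
      {(St.chk (info x), d0)})
  let ρ' : Pos → Set (St Q (Info Q) × D) := fun x =>
    if IsLeaf τ x then Set.image (fun qd : Q × D => (St.start, qd.2)) (ρ x) else R x
  have hρr : ∀ y, ¬ IsLeaf τ y → ∀ r e, (r, e) ∈ ρ y → (St.run r, e) ∈ ρ' y := by
    intro y hl r e hr
    simp only [ρ', if_neg hl]
    exact .inl ⟨_, hr, rfl⟩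
  have hsup : ∀ y i, y ++ [i] ∈ τ.pos → ∀ d, ∀ a ∈ sup (info y),
      actOK τ (y ++ [i]) y ρ' d a := by
    intro y i hx d
    have hl : ¬ IsLeaf τ y := fun h => h i hx
    refine (sup_ok τ ρ' _ _ _ _).2 ⟨⟨d0, ?_⟩, ?_, ?_, ?_⟩
    · simp only [ρ', if_neg hl]
      exact .inr (.inr rfl)
    · rintro p ⟨e, he⟩
      exact ⟨e, hρr y hl _ _ he⟩
    · intro p hp
      refine ⟨τ.data y, ?_⟩
      simp only [ρ', if_neg hl]
      exact .inr (.inl ⟨_, ⟨hp, rfl⟩, rfl⟩)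
    · intro p hp e he
      exact hρr y hl _ _ (hp e (subtreeData_mono τ y i he))
  -- bundles
  have hbun : ∀ y i, y ++ [i] ∈ τ.pos → ∀ q d, (q, d) ∈ ρ (y ++ [i]) → ∃ f, q ∈ dom δ f ∧
      Sem isEps δ τ bl' ρ' (y ++ [i]) y d f := by
    intro y i hx q d hq
    have hyl : ¬ IsLeaf τ y := fun h => h i hx
    have hch : ∀ p, (p, d) ∈ ρ (y ++ [i]) → ∃ j : Fin δ.length,
        testHolds τ bl (y ++ [i]) p d (δ.get j).1 ∧
          ∀ a ∈ (δ.get j).2, epsActOK isEps τ (y ++ [i]) y ρ d a := by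
      intro p hp
      obtain ⟨tr, htr, ht⟩ := hrun y i hx (p, d) hp
      obtain ⟨j, rfl⟩ := List.get_of_mem htr
      exact ⟨j, ht⟩
    let f : Q → Option (Fin δ.length) := fun p =>
      if hp : (p, d) ∈ ρ (y ++ [i]) then some (hch p hp).choose else none
    have hdom : ∀ p, (p, d) ∈ ρ (y ++ [i]) → p ∈ dom δ f := fun p hp =>
      ⟨(hch p hp).choose, by simp only [f, dif_pos hp]⟩
    refine ⟨f, hdom q hq, ?_⟩
    intro p j hj
    by_cases hp : (p, d) ∈ ρ (y ++ [i])
    · have hj' : (hch p hp).choose = j := by simpa only [f, dif_pos hp, Option.some.injEq] using hj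
      have hs := (hch p hp).choose_spec
      rw [hj'] at hs
      refine ⟨hs.1, fun a ha => ⟨?_, fromEps isEps τ _ _ ρ ρ' d a (hρr y hyl) (hs.2 a ha)⟩⟩
      have hok := hs.2 a ha
      cases a with
      | accept => trivial
      | keep r =>
        intro hr
        simp only [epsActOK, hr, if_true] at hok
        exact hdom r hok
      | store r =>
        intro hr
        simp only [epsActOK, hr, if_true] at hok
        exact hok
      | guess r =>
        intro hr
        simp only [epsActOK, hr, if_true] at hok
        exact hok
      | univ r =>
        intro hr
        simp only [epsActOK, hr, if_true] at hok
        exact ⟨hok _ (data_mem_subtree τ _ hx), hok⟩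
    · simp [f, dif_neg hp] at hj
  refine ⟨bl', ρ', ⟨?_, ?_, ?_⟩, ?_⟩
  · intro x hx
    simp only [ρ']
    split_ifs
    · exact (hfin x hx).image _
    · exact ((hfin x hx).image _).union ((((hfin x hx).subset (Set.sep_subset _ _)).image _).union
        (Set.finite_singleton _))
  · intro x hx hl
    obtain ⟨e, he⟩ := hleaf x hx hl
    exact ⟨e, by simp [ρ', if_pos hl, he]⟩
  · rintro y i hx sd hsd
    have hyl : ¬ IsLeaf τ y := fun h => h i hx
    by_cases hl : IsLeaf τ (y ++ [i])
    · simp only [ρ', if_pos hl] at hsd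
      obtain ⟨⟨q, d⟩, hq, rfl⟩ := hsd
      obtain ⟨e, he⟩ := hleaf _ hx hl
      obtain ⟨tr, htr, ht, ha⟩ := hrun y i hx _ hq
      obtain ⟨j, rfl⟩ := List.get_of_mem htr
      have hq0 : ∀ p e, (p, e) ∈ ρ (y ++ [i]) → p = q0 := by
        intro p e' hp
        rw [he] at hp
        exact (Prod.mk.inj hp).1
      obtain rfl := hq0 q d hq
      obtain ⟨h1, h2⟩ := (pure_rest τ bl' (y ++ [i]) q
        (St.start : St Q (Info Q)) d (δ.get j).1).2 ht
      refine ⟨_, (hδ' _).2 (.inl (.inl (.inr ⟨j, bl' (y ++ [i]), info y, h1, ?_, rfl⟩))), ?_, ?_⟩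
      · intro a haa p hp
        by_contra hne
        have hpe : isEps p = true := by simpa using hne
        obtain ⟨nt, hnt, hn, q', hq', hlt⟩ := guarded _ htr a haa p hp hpe
        have h3 := (ht nt hnt).2 hn
        rw [hq'] at h3
        have h4 : q = q' := h3
        have h5 : ∃ e, (p, e) ∈ ρ (y ++ [i]) := by
          have := ha a haa
          cases a with
          | accept => simp [actTarget] at hp
          | keep r =>
            obtain rfl : r = p := by simpa [actTarget] using hp
            simp only [epsActOK, hpe, if_true] at this
            exact ⟨_, this⟩
          | store r =>
            obtain rfl : r = p := by simpa [actTarget] using hp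
            simp only [epsActOK, hpe, if_true] at this
            exact ⟨_, this⟩
          | guess r =>
            obtain rfl : r = p := by simpa [actTarget] using hp
            simp only [epsActOK, hpe, if_true] at this
            exact this
          | univ r =>
            obtain rfl : r = p := by simpa [actTarget] using hp
            simp only [epsActOK, hpe, if_true] at this
            exact ⟨_, this _ (data_mem_subtree τ _ hx)⟩
        obtain ⟨e', he'⟩ := h5
        have h6 := hq0 p e' he'
        rw [← h4, h6] at hlt
        exact irr _ hlt
      · simp only [testHolds_append, testHolds_hd]
        exact ⟨⟨by trivial, by trivial⟩, h2⟩
      · intro a' ha'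
        rcases List.mem_append.1 ha' with ha' | ha'
        · obtain ⟨a, haa, ha'⟩ := List.mem_flatMap.1 ha'
          exact fromEps isEps τ _ _ ρ ρ' d a (hρr y hyl) (ha a haa) a' ha'
        · exact hsup y i hx d a' ha'
    · simp only [ρ', if_neg hl] at hsd
      rcases hsd with ⟨⟨q, d⟩, hq, rfl⟩ | ⟨⟨q, d⟩, ⟨hq, hd⟩, rfl⟩ | hsd
      · obtain ⟨f, hf, hs⟩ := hbun y i hx q d hq
        obtain ⟨h1, h2, h3⟩ := of_sem isEps δ τ bl' ρ' _ _ (.run q) d f hs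
        refine ⟨_, (hδ' _).2 (.inl (.inl (.inl (.inl (.inl ⟨q, f, _, hf, h1, rfl⟩))))), ?_, h3⟩
        simp only [testHolds_append, testHolds_hd]
        exact ⟨⟨by trivial, by trivial⟩, h2⟩
      · obtain ⟨f, hf, hs⟩ := hbun y i hx q d hq
        obtain ⟨h1, h2, h3⟩ := of_sem isEps δ τ bl' ρ' _ _ (.st q) d f hs
        refine ⟨_, (hδ' _).2 (.inl (.inl (.inl (.inl (.inr ⟨q, f, _, hf, h1, rfl⟩))))), ?_, h3⟩
        simp only [testHolds_append, testHolds_hd, testHolds_cons]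
        exact ⟨⟨by trivial, by trivial⟩, ⟨fun _ => by trivial, fun _ => hd.symm⟩, h2⟩
      · obtain rfl := hsd
        refine ⟨_, (hδ' _).2 (.inl (.inl (.inl (.inr ⟨bl' (y ++ [i]), info y, rfl⟩)))), ?_,
          hsup y i hx d0⟩
        simp only [testHolds_hd]
        exact ⟨by trivial, by trivial⟩
  · have hbase : ∀ s q d, base q0 s = some q → (q, d) ∈ ρ [] →
        ∃ t, (t, [BAct.accept]) ∈ δ' ∧ testHolds τ bl' [] s d t := by
      intro s q d hs hq
      obtain ⟨t, ht, hh⟩ := hacc _ hq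
      obtain ⟨j, hj⟩ := List.get_of_mem ht
      have e1 : (δ.get j).1 = t := by rw [hj]
      have e2 : (δ.get j).2 = [BAct.accept] := by rw [hj]
      rw [← e1] at hh
      obtain ⟨h1, h2⟩ := (pure_rest τ bl' [] q s d (δ.get j).1).2 hh
      refine ⟨_, (hδ' _).2 (.inl (.inr ⟨j, bl' [], s, q, hs, e2, h1, rfl⟩)), ?_⟩
      simp only [testHolds_append, testHolds_hd, testHolds_cons]
      exact ⟨⟨by trivial, by trivial⟩, ⟨fun _ => by trivial, fun _ => by trivial⟩, h2⟩
    intro sd hsd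
    by_cases hl : IsLeaf τ ([] : Pos)
    · simp only [ρ', if_pos hl] at hsd
      obtain ⟨⟨q, d⟩, hq, rfl⟩ := hsd
      obtain ⟨e, he⟩ := hleaf _ τ.root_mem hl
      have : q = q0 := by
        rw [he] at hq
        exact (Prod.mk.inj hq).1
      exact hbase _ q d (by rw [this]; rfl) hq
    · simp only [ρ', if_neg hl] at hsd
      rcases hsd with ⟨⟨q, d⟩, hq, rfl⟩ | ⟨⟨q, d⟩, ⟨hq, hd⟩, rfl⟩ | hsd
      · exact hbase _ q d rfl hq
      · exact hbase _ q d rfl hq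
      · obtain rfl := hsd
        refine ⟨_, (hδ' _).2 (.inr ⟨bl' [], rfl⟩), ?_⟩
        simp only [testHolds_append, testHolds_hd, testHolds_cons]
        exact ⟨⟨by trivial, by trivial⟩, ⟨fun _ => by trivial, fun _ => by trivial⟩, by simp [testHolds]⟩

end Constr

/-- The ε-free automaton. -/
noncomputable def elim {A : Type} (M : EpsBUDTA A) : BUDTA A :=
  haveI := M.Bfin
  haveI := M.Qfin
  { B := M.B × Info M.Q
    Bfin := inferInstance
    Q := St M.Q (Info M.Q)
    Qfin := inferInstance
    q0 := .start
    δ := (TT_finite M.isEps M.q0 M.δ).toFinset.toList }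

/-- **ε-transitions can be eliminated**: there is an effective,
language-preserving translation from BUDTA with ε-transitions into BUDTA. -/
theorem budta_eps_elimination (A D : Type) [Fintype A] [Infinite D] :
    ∃ F : EpsBUDTA A → BUDTA A,
      ∀ (M : EpsBUDTA A) (τ : DataTree A D),
        Accepts (F M) τ ↔ EpsAccepts M τ := by
  refine ⟨elim, fun M τ => ?_⟩
  have := M.Bfin
  have := M.Qfin
  have hδ : ∀ tr, tr ∈ (TT_finite M.isEps M.q0 M.δ).toFinset.toList ↔
      tr ∈ TT M.isEps M.q0 M.δ := by
    intro tr
    simp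
  constructor
  · rintro ⟨bl, ρ', h⟩
    obtain ⟨ρ, hρ⟩ := dir1 M.isEps M.q0 M.δ _ hδ τ bl ρ' h
    exact ⟨_, ρ, hρ⟩
  · rintro ⟨bl, ρ, h⟩
    exact dir2 M.isEps M.q0 M.δ M.lt M.lt_irrefl M.eps_guarded _ hδ τ bl ρ h

end BUDA
end

section
/- The relation ⪯ on extended configurations is a well-quasi-order: it is reflexive and transitive, and every infinite sequence θ₁, θ₂, θ₃, … of extended configurations contains indices i < j with θᵢ ⪯ θⱼ. -/
namespace ECBUDA

/-- Evaluation of a nonempty word under the semigroup homomorphism determined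
by the letter map `h` (and `none` on the empty word). -/
def hword {A B S : Type} [Mul S] (h : A × B → S) : List (A × B) → Option S
  | [] => none
  | c :: w => some (w.foldl (fun s x => s * h x) (h c))

/-- (NF1): the homomorphism takes distinct values on words of length one:
`h(w) = h(c)` iff `w = c`. -/
def NF1 {A B S : Type} [Mul S] (h : A × B → S) : Prop :=
  ∀ (w : List (A × B)) (c : A × B), hword h w = some (h c) ↔ w = [c]

/-- Basic tests allowed in normal form (NF2): state tests, `⟨μ⟩^=`, `⟨μ⟩^≠`
and `root`. -/
inductive NTest (Q S : Type) : Type where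
  | state : Q → NTest Q S
  | deq : S → NTest Q S
  | dneq : S → NTest Q S
  | root : NTest Q S

/-- Basic actions. -/
inductive NAct (Q : Type) : Type where
  | accept : NAct Q
  | keep : Q → NAct Q
  | store : Q → NAct Q
  | guess : Q → NAct Q
  | univ : Q → NAct Q

/-- The set `TA`: possibly negated basic tests (the Boolean flag `true` marks
negation), basic actions, and the three symbols `⊤`, `⊤g`, `⊥`. -/
inductive TA (Q S : Type) : Type where
  | test : Bool → NTest Q S → TA Q S
  | act : NAct Q → TA Q S
  | top : TA Q S
  | topg : TA Q S
  | bot : TA Q S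

/-- A transition of the automaton in normal form: a conjunction of possibly
negated basic tests with a conjunction of basic actions. -/
abbrev NTrans (Q S : Type) : Type := List (Bool × NTest Q S) × List (NAct Q)

/-- An extended configuration `(Δ, Γ, r, m)`: `Δ` a finite set of threads,
`Γ` a finite set of pairs (semigroup element, data value) containing exactly
one pair whose first component is the image under `h` of a letter (this letter
is the label of the configuration and the associated data value its data
value), and Booleans `r` (root) and `m` (merge). -/
structure EConf (A B Q S : Type) (D : Type) (h : A × B → S) : Type where
  Δ : Set (Q × TA Q S × D)
  Γ : Set (S × D)
  r : Bool
  m : Bool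
  finΔ : Δ.Finite
  finΓ : Γ.Finite
  uniq : ∃! x : S × D, x ∈ Γ ∧ ∃ c : A × B, x.1 = h c

variable {A B Q S D : Type} {h : A × B → S}

/-- `Δ(d)`: the threads carrying the data value `d`. -/
def EConf.dfun (θ : EConf A B Q S D h) (d : D) : Set (Q × TA Q S) :=
  {qa | (qa.1, qa.2, d) ∈ θ.Δ}

/-- `Γ(d)`: the semigroup elements of downward paths leading to `d`. -/
def EConf.gfun (θ : EConf A B Q S D h) (d : D) : Set S :=
  {μ | (μ, d) ∈ θ.Γ}

/-- The data values occurring in the extended configuration. -/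
def EConf.dataset (θ : EConf A B Q S D h) : Set D :=
  {d | (∃ qa : Q × TA Q S, (qa.1, qa.2, d) ∈ θ.Δ) ∨ ∃ μ : S, (μ, d) ∈ θ.Γ}

/-- The unique pair of `Γ` recording the label and the data value of the root. -/
def EConf.rootInfo (θ : EConf A B Q S D h) : Set (S × D) :=
  {x ∈ θ.Γ | ∃ c : A × B, x.1 = h c}

/-- The set of data values of the root pair (a singleton). -/
def EConf.rootData (θ : EConf A B Q S D h) : Set D :=
  {d | ∃ μ : S, (μ, d) ∈ θ.Γ ∧ ∃ c : A × B, μ = h c}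

/-- The profile `(A₀, A₁, r, m)` of an extended configuration: `Aᵢ` is the set
of those `χ ⊆ S` such that exactly `i` data values `d` satisfy `Γ(d) = χ`. -/
def EConf.profile (θ : EConf A B Q S D h) :
    Set (Set S) × Set (Set S) × Bool × Bool :=
  ({χ | {d | θ.gfun d = χ}.encard = 0},
   {χ | {d | θ.gfun d = χ}.encard = 1}, θ.r, θ.m)

/-- `θ₁ ⪯_f θ₂`. -/
def pleF (f : D → D) (θ₁ θ₂ : EConf A B Q S D h) : Prop :=
  θ₁.profile = θ₂.profile ∧ θ₁.dataset ⊆ Set.range f ∧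
  ∀ d : D, θ₁.dfun (f d) ⊆ θ₂.dfun d ∧ θ₁.gfun (f d) = θ₂.gfun d

/-- The well-quasi-order `⪯` on extended configurations. -/
def ple (θ₁ θ₂ : EConf A B Q S D h) : Prop :=
  ∃ f : D → D, pleF f θ₁ θ₂

/-- `θ₁ ∼ θ₂`: equal up to a bijection of the data values. -/
def simEquiv (θ₁ θ₂ : EConf A B Q S D h) : Prop :=
  ∃ g : D ≃ D,
    θ₂.Δ = {x | (x.1, x.2.1, g.symm x.2.2) ∈ θ₁.Δ} ∧
    θ₂.Γ = {x | (x.1, g.symm x.2) ∈ θ₁.Γ} ∧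
    θ₂.r = θ₁.r ∧ θ₂.m = θ₁.m

/-- The closure of a set of extended configurations under `∼`. -/
def simClose (Θ : Set (EConf A B Q S D h)) : Set (EConf A B Q S D h) :=
  {θ | ∃ θ' ∈ Θ, simEquiv θ θ'}

/-- `Θ ≤min Θ'`: every member of `Θ'` is minorized by a member of `Θ`. -/
def leMin (Θ Θ' : Set (EConf A B Q S D h)) : Prop :=
  ∀ θ' ∈ Θ', ∃ θ ∈ Θ, ple θ θ'

/-- Satisfaction of a basic test by the thread `(q, d)` in an extended
configuration. -/
def ntestHolds (θ : EConf A B Q S D h) (q : Q) (d : D) : NTest Q S → Prop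
  | .state p => q = p
  | .deq μ => (μ, d) ∈ θ.Γ
  | .dneq μ => ∃ e : D, e ≠ d ∧ (μ, e) ∈ θ.Γ
  | .root => θ.r = true

def taTestHolds (θ : EConf A B Q S D h) (q : Q) (d : D) (neg : Bool)
    (t : NTest Q S) : Prop :=
  if neg then ¬ ntestHolds θ q d t else ntestHolds θ q d t

/-- The tests and actions occurring in a transition, as elements of `TA`. -/
def taSet (tr : NTrans Q S) : Set (TA Q S) :=
  {x | (∃ nt ∈ tr.1, x = TA.test nt.1 nt.2) ∨ ∃ a ∈ tr.2, x = TA.act a}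

/-- The ε-transitions of the transition system: they keep `Γ`, `r` (hence the
label and data value), require the merge flag to be false, and rewrite one
thread of `Δ`. -/
def epsStep (δ : List (NTrans Q S)) (θ₁ θ₂ : EConf A B Q S D h) : Prop :=
  θ₁.m = false ∧ θ₂.m = false ∧ θ₂.r = θ₁.r ∧ θ₂.Γ = θ₁.Γ ∧
  ∃ (q : Q) (d : D),
    -- applying a transition of δ to a ⊥-thread
    ((∃ tr ∈ δ, (q, TA.bot, d) ∈ θ₁.Δ ∧
        θ₂.Δ = (θ₁.Δ \ {(q, TA.bot, d)}) ∪
          {x | x.1 = q ∧ x.2.2 = d ∧ x.2.1 ∈ taSet tr}) ∨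
    -- univ
    (∃ p : Q, (q, TA.act (NAct.univ p), d) ∈ θ₁.Δ ∧
        θ₂.Δ = (θ₁.Δ \ {(q, TA.act (NAct.univ p), d)}) ∪
          {x | x.1 = p ∧ x.2.1 = TA.top ∧ ∃ μ : S, (μ, x.2.2) ∈ θ₁.Γ}) ∨
    -- guess
    (∃ (p : Q) (d' : D), (q, TA.act (NAct.guess p), d) ∈ θ₁.Δ ∧
        θ₂.Δ = (θ₁.Δ \ {(q, TA.act (NAct.guess p), d)}) ∪ {(p, TA.topg, d')}) ∨
    -- store
    (∃ (p : Q) (d' : D), (q, TA.act (NAct.store p), d) ∈ θ₁.Δ ∧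
        d' ∈ θ₁.rootData ∧
        θ₂.Δ = (θ₁.Δ \ {(q, TA.act (NAct.store p), d)}) ∪ {(p, TA.top, d')}) ∨
    -- keep
    (∃ p : Q, (q, TA.act (NAct.keep p), d) ∈ θ₁.Δ ∧
        θ₂.Δ = (θ₁.Δ \ {(q, TA.act (NAct.keep p), d)}) ∪ {(p, TA.top, d)}) ∨
    -- accept
    ((q, TA.act NAct.accept, d) ∈ θ₁.Δ ∧
        θ₂.Δ = θ₁.Δ \ {(q, TA.act NAct.accept, d)}) ∨
    -- a (possibly negated) basic test, deleted if it holds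
    (∃ (neg : Bool) (t : NTest Q S), (q, TA.test neg t, d) ∈ θ₁.Δ ∧
        taTestHolds θ₁ q d neg t ∧
        θ₂.Δ = θ₁.Δ \ {(q, TA.test neg t, d)}))

/-- The transition `→inc(S, χ)`. -/
def incStep (Sq : Set (Q × TA Q S)) (χ : Set S) (θ₁ θ₂ : EConf A B Q S D h) :
    Prop :=
  (∃ d : D, θ₁.dfun d = Sq ∧ θ₁.gfun d = χ) ∧
  (∃ e₁ e₂ : D, e₁ ≠ e₂ ∧ θ₁.gfun e₁ = χ ∧ θ₁.gfun e₂ = χ) ∧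
  ∃ e : D, e ∉ θ₁.dataset ∧ θ₂.r = θ₁.r ∧ θ₂.m = θ₁.m ∧
    (∀ d : D, d ≠ e → θ₂.dfun d = θ₁.dfun d ∧ θ₂.gfun d = θ₁.gfun d) ∧
    θ₂.dfun e = {qa ∈ Sq | qa.2 ≠ TA.topg} ∧ θ₂.gfun e = χ

/-- The transition `→inc`. -/
def inc (θ₁ θ₂ : EConf A B Q S D h) : Prop :=
  ∃ (Sq : Set (Q × TA Q S)) (χ : Set S), incStep Sq χ θ₁ θ₂

/-- The transition `→grow`, adding a new root on top. -/
def growStep [Semigroup S] (θ₁ θ₂ : EConf A B Q S D h) : Prop :=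
  θ₁.r = false ∧ θ₁.m = false ∧
  (∀ x ∈ θ₁.Δ, x.2.1 = TA.top ∨ x.2.1 = TA.topg) ∧
  θ₂.Δ = {x | x.2.1 = TA.bot ∧ ∃ α : TA Q S, (x.1, α, x.2.2) ∈ θ₁.Δ} ∧
  ∃ (c : A × B) (d' : D),
    θ₂.Γ = {y | ∃ μ : S, ∃ e : D, (μ, e) ∈ θ₁.Γ ∧ y = (h c * μ, e)} ∪ {(h c, d')}

/-- The transition `→merge`, merging two extended configurations with the same
label and data value. -/
def mergeStep (θ₁ θ₂ θ₀ : EConf A B Q S D h) : Prop :=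
  θ₁.rootInfo = θ₂.rootInfo ∧ θ₀.rootInfo = θ₁.rootInfo ∧
  θ₁.m = true ∧ θ₂.m = true ∧ θ₀.r = θ₁.r ∧ θ₁.r = θ₂.r ∧
  θ₀.Δ = θ₁.Δ ∪ θ₂.Δ ∧ θ₀.Γ = θ₁.Γ ∪ θ₂.Γ

/-- Any single (ε-, inc- or grow-) transition step of the transition system. -/
def anyStep [Semigroup S] (δ : List (NTrans Q S)) (θ₁ θ₂ : EConf A B Q S D h) :
    Prop :=
  epsStep δ θ₁ θ₂ ∨ inc θ₁ θ₂ ∨ growStep θ₁ θ₂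

/-- `Θ ⟹ θ`: one derivation step from a set of extended configurations. -/
def stepFrom [Semigroup S] (δ : List (NTrans Q S))
    (Θ : Set (EConf A B Q S D h)) (θ : EConf A B Q S D h) : Prop :=
  (∃ θ₁ ∈ Θ, anyStep δ θ₁ θ) ∨ ∃ θ₁ ∈ Θ, ∃ θ₂ ∈ Θ, mergeStep θ₁ θ₂ θ

/-- `Θ ⟹⁺ θ`. -/
inductive Derives [Semigroup S] (δ : List (NTrans Q S)) :
    Set (EConf A B Q S D h) → EConf A B Q S D h → Prop where
  | base {Θ : Set (EConf A B Q S D h)} {θ : EConf A B Q S D h} :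
      stepFrom δ Θ θ → Derives δ Θ θ
  | step {Θ : Set (EConf A B Q S D h)} {θ' θ : EConf A B Q S D h} :
      stepFrom δ Θ θ' → Derives δ (Θ ∪ {θ'}) θ → Derives δ Θ θ

/-- `Θ ⟹ⁿ θ`: derivation in at most `n` steps. -/
inductive DerivesN [Semigroup S] (δ : List (NTrans Q S)) :
    ℕ → Set (EConf A B Q S D h) → EConf A B Q S D h → Prop where
  | base {n : ℕ} {Θ : Set (EConf A B Q S D h)} {θ : EConf A B Q S D h} :
      stepFrom δ Θ θ → DerivesN δ (n + 1) Θ θ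
  | step {n : ℕ} {Θ : Set (EConf A B Q S D h)} {θ' θ : EConf A B Q S D h} :
      stepFrom δ Θ θ' → DerivesN δ n (Θ ∪ {θ'}) θ → DerivesN δ (n + 1) Θ θ

/-- `n`-fold composition of a binary relation. -/
def relPow {α : Type} (R : α → α → Prop) : ℕ → α → α → Prop
  | 0 => Eq
  | n + 1 => fun a c => ∃ b, R a b ∧ relPow R n b c

/-- An initial extended configuration (abstracting a leaf). -/
def Initial (q0 : Q) (θ : EConf A B Q S D h) : Prop :=
  (∃ d : D, θ.Δ = {(q0, TA.bot, d)}) ∧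
  ∃ (c : A × B) (d' : D), θ.Γ = {(h c, d')}

/-- An accepting extended configuration: no remaining threads. -/
def Accepting (θ : EConf A B Q S D h) : Prop := θ.Δ = ∅

theorem finite_NTest (Q S : Type) [Finite Q] [Finite S] : Finite (NTest Q S) := by
  let g : Q ⊕ S ⊕ S ⊕ Unit → NTest Q S := fun x => match x with
    | .inl q => .state q
    | .inr (.inl s) => .deq s
    | .inr (.inr (.inl s)) => .dneq s
    | .inr (.inr (.inr _)) => .root
  refine Finite.of_surjective g ?_
  intro t
  cases t with
  | state q => exact ⟨.inl q, rfl⟩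
  | deq s => exact ⟨.inr (.inl s), rfl⟩
  | dneq s => exact ⟨.inr (.inr (.inl s)), rfl⟩
  | root => exact ⟨.inr (.inr (.inr ())), rfl⟩

theorem finite_NAct (Q : Type) [Finite Q] : Finite (NAct Q) := by
  let g : Unit ⊕ Q ⊕ Q ⊕ Q ⊕ Q → NAct Q := fun x => match x with
    | .inl _ => .accept
    | .inr (.inl s) => .keep s
    | .inr (.inr (.inl s)) => .store s
    | .inr (.inr (.inr (.inl s))) => .guess s
    | .inr (.inr (.inr (.inr s))) => .univ s
  refine Finite.of_surjective g ?_
  intro t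
  cases t with
  | accept => exact ⟨.inl (), rfl⟩
  | keep s => exact ⟨.inr (.inl s), rfl⟩
  | store s => exact ⟨.inr (.inr (.inl s)), rfl⟩
  | guess s => exact ⟨.inr (.inr (.inr (.inl s))), rfl⟩
  | univ s => exact ⟨.inr (.inr (.inr (.inr s))), rfl⟩

theorem finite_TA (Q S : Type) [Finite Q] [Finite S] : Finite (TA Q S) := by
  have := finite_NTest Q S
  have := finite_NAct Q
  let g : (Bool × NTest Q S) ⊕ NAct Q ⊕ Fin 3 → TA Q S := fun x => match x with
    | .inl p => .test p.1 p.2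
    | .inr (.inl s) => .act s
    | .inr (.inr 0) => .top
    | .inr (.inr 1) => .topg
    | .inr (.inr 2) => .bot
  refine Finite.of_surjective g ?_
  intro t
  cases t with
  | test b t => exact ⟨.inl (b, t), rfl⟩
  | act s => exact ⟨.inr (.inl s), rfl⟩
  | top => exact ⟨.inr (.inr 0), rfl⟩
  | topg => exact ⟨.inr (.inr 1), rfl⟩
  | bot => exact ⟨.inr (.inr 2), rfl⟩

/-- The type of a data value in an extended configuration. -/
def EConf.ty (θ : EConf A B Q S D h) (d : D) : Set (Q × TA Q S) × Set S :=
  (θ.dfun d, θ.gfun d)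

theorem EConf.dataset_finite (θ : EConf A B Q S D h) : θ.dataset.Finite := by
  refine ((θ.finΔ.image (fun x => x.2.2)).union (θ.finΓ.image (fun x => x.2))).subset ?_
  rintro d (⟨qa, hq⟩ | ⟨μ, hμ⟩)
  · exact Or.inl ⟨_, hq, rfl⟩
  · exact Or.inr ⟨_, hμ, rfl⟩

theorem EConf.ty_of_mem (θ : EConf A B Q S D h) {d : D} (hd : d ∈ θ.dataset) :
    θ.ty d ≠ (∅, ∅) := by
  intro he
  have h1 : θ.dfun d = ∅ := congrArg Prod.fst he
  have h2 : θ.gfun d = ∅ := congrArg Prod.snd he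
  rcases hd with ⟨qa, hq⟩ | ⟨μ, hμ⟩
  · have : qa ∈ θ.dfun d := hq
    simp [h1] at this
  · have : μ ∈ θ.gfun d := hμ
    simp [h2] at this

theorem EConf.mem_of_ty (θ : EConf A B Q S D h) {d : D} (hd : θ.ty d ≠ (∅, ∅)) :
    d ∈ θ.dataset := by
  by_contra hn
  apply hd
  refine Prod.ext ?_ ?_
  · refine Set.eq_empty_iff_forall_notMem.2 fun qa hq => hn (Or.inl ⟨qa, hq⟩)
  · refine Set.eq_empty_iff_forall_notMem.2 fun μ hq => hn (Or.inr ⟨μ, hq⟩)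

theorem exists_surj_on [Nonempty D] {X Y : Set D} (hXY : Y.Nonempty → X.Nonempty)
    (hle : X.encard ≤ Y.encard) :
    ∃ g : D → D, (∀ d ∈ Y, g d ∈ X) ∧ (X.Finite → ∀ e ∈ X, ∃ d ∈ Y, g d = e) := by
  classical
  by_cases hX : X.Nonempty
  · obtain ⟨x0, hx0⟩ := hX
    by_cases hf : X.Finite
    · obtain ⟨φ, h1, h2⟩ := hf.exists_injOn_of_encard_le hle
      refine ⟨fun d => if d ∈ φ '' X then Function.invFunOn φ X d else x0, ?_, ?_⟩
      · intro d _
        dsimp only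
        split_ifs with hd
        · exact Function.invFunOn_mem hd
        · exact hx0
      · intro _ e he
        refine ⟨φ e, h1 he, ?_⟩
        dsimp only
        rw [if_pos (Set.mem_image_of_mem φ he)]
        exact h2.leftInvOn_invFunOn he
    · exact ⟨fun _ => x0, fun _ _ => hx0, fun hf' => absurd hf' hf⟩
  · exact ⟨id, fun d hd => absurd (hXY ⟨d, hd⟩) hX, fun _ e he => absurd ⟨e, he⟩ hX⟩

theorem ple_of_counts [Nonempty D] (θ₁ θ₂ : EConf A B Q S D h)
    (hp : θ₁.profile = θ₂.profile)
    (hs : {t | ∃ d, θ₁.ty d = t} = {t | ∃ d, θ₂.ty d = t})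
    (hc : ∀ t, {d | θ₁.ty d = t}.encard ≤ {d | θ₂.ty d = t}.encard) : ple θ₁ θ₂ := by
  have key : ∀ t, ∃ g : D → D, (∀ d ∈ {d | θ₂.ty d = t}, g d ∈ {d | θ₁.ty d = t}) ∧
      ({d | θ₁.ty d = t}.Finite → ∀ e ∈ {d | θ₁.ty d = t},
        ∃ d ∈ {d | θ₂.ty d = t}, g d = e) := by
    intro t
    refine exists_surj_on ?_ (hc t)
    intro hn
    have : t ∈ {t | ∃ d, θ₂.ty d = t} := hn
    rw [← hs] at this
    exact this
  choose g hg1 hg2 using key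
  refine ⟨fun d => g (θ₂.ty d) d, hp, ?_, ?_⟩
  · intro e he
    have hfin : {d | θ₁.ty d = θ₁.ty e}.Finite := by
      refine θ₁.dataset_finite.subset fun d hd => θ₁.mem_of_ty ?_
      rw [show θ₁.ty d = θ₁.ty e from hd]
      exact θ₁.ty_of_mem he
    obtain ⟨d, hd, hde⟩ := hg2 _ hfin e rfl
    refine ⟨d, ?_⟩
    have hd' : θ₂.ty d = θ₁.ty e := hd
    simp only [hd', hde]
  · intro d
    have hd : θ₁.ty (g (θ₂.ty d) d) = θ₂.ty d := hg1 (θ₂.ty d) d rfl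
    exact ⟨(congrArg Prod.fst hd).subset, congrArg Prod.snd hd⟩

theorem mem_dataset_of_pleF {f : D → D} {θ₁ θ₂ : EConf A B Q S D h} (hf : pleF f θ₁ θ₂)
    {d : D} (hd : f d ∈ θ₁.dataset) : d ∈ θ₂.dataset := by
  rcases hd with ⟨qa, hq⟩ | ⟨μ, hμ⟩
  · exact Or.inl ⟨qa, (hf.2.2 d).1 hq⟩
  · exact Or.inr ⟨μ, (hf.2.2 d).2.subset (show μ ∈ θ₁.gfun (f d) from hμ)⟩

/-- **`⪯` is a well-quasi-order on extended configurations**: it is reflexive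
and transitive, and every infinite sequence of extended configurations contains
two comparable members in order. -/
theorem ple_is_wqo (A B Q S D : Type) [Fintype A] [Fintype B] [Fintype Q]
    [Fintype S] [Semigroup S] [Infinite D] (h : A × B → S) (hNF1 : NF1 h) :
    (∀ θ : EConf A B Q S D h, ple θ θ) ∧
    (∀ θ₁ θ₂ θ₃ : EConf A B Q S D h, ple θ₁ θ₂ → ple θ₂ θ₃ → ple θ₁ θ₃) ∧
    (∀ seq : ℕ → EConf A B Q S D h, ∃ i j : ℕ, i < j ∧ ple (seq i) (seq j)) := by
  have := finite_TA Q S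
  refine ⟨fun θ => ⟨id, rfl, by simp, fun d => ⟨subset_rfl, rfl⟩⟩, ?_, ?_⟩
  · rintro θ₁ θ₂ θ₃ ⟨f, hf⟩ ⟨g, hg⟩
    refine ⟨f ∘ g, hf.1.trans hg.1, ?_, fun d => ⟨?_, ?_⟩⟩
    · intro d hd
      obtain ⟨e, rfl⟩ := hf.2.1 hd
      obtain ⟨e', rfl⟩ := hg.2.1 (mem_dataset_of_pleF hf hd)
      exact ⟨e', rfl⟩
    · exact (hf.2.2 (g d)).1.trans (hg.2.2 d).1
    · exact (hf.2.2 (g d)).2.trans (hg.2.2 d).2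
  · intro seq
    let T := Set (Q × TA Q S) × Set S
    let P := (Set (Set S) × Set (Set S) × Bool × Bool) × Set T
    have hP : WellQuasiOrdered (fun a b : P => a = b) := Finite.wellQuasiOrdered _
    have hN : WellQuasiOrdered (fun a b : T → ℕ∞ => a ≤ b) := wellQuasiOrdered_le
    obtain ⟨i, j, hij, h1, h2⟩ := hP.prod hN (fun n =>
      (((seq n).profile, {t | ∃ d, (seq n).ty d = t}),
        fun t => {d | (seq n).ty d = t}.encard))
    refine ⟨i, j, hij, ple_of_counts _ _ (congrArg Prod.fst h1) (congrArg Prod.snd h1) ?_⟩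
    exact fun t => h2 t

end ECBUDA
end

section
/- Let θ and θ' be extended configurations with θ' ⪯ θ and let d ∈ 𝔻. Then there exist an extended configuration θ̃ and a function f : 𝔻 → 𝔻 such that: (1) θ' reaches θ̃ by n applications of →inc for some n ≤ 2^{|𝒮|} + 1; (2) θ̃ ⪯_f θ; and (3) f⁻¹(f(d)) = {d}. -/
namespace ECBUDA

variable {A B Q S D : Type} {h : A × B → S}

theorem EConf.dfun_empty {θ : EConf A B Q S D h} {x : D} (hx : x ∉ θ.dataset) :
    θ.dfun x = ∅ := by
  ext qa
  simp only [EConf.dfun, Set.mem_ofPred_eq, Set.mem_empty_iff_false, iff_false]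
  exact fun hq => hx (Or.inl ⟨qa, hq⟩)

theorem EConf.gfun_empty {θ : EConf A B Q S D h} {x : D} (hx : x ∉ θ.dataset) :
    θ.gfun x = ∅ := by
  ext μ
  simp only [EConf.gfun, Set.mem_ofPred_eq, Set.mem_empty_iff_false, iff_false]
  exact fun hq => hx (Or.inr ⟨μ, hq⟩)

/-- Profiles agree if every fibre of `gfun` is either unchanged or has at least two
elements on both sides. -/
theorem profile_eq_of {θ₁ θ₂ : EConf A B Q S D h} (hr : θ₁.r = θ₂.r) (hm : θ₁.m = θ₂.m)
    (H : ∀ χ : Set S, {d | θ₁.gfun d = χ} = {d | θ₂.gfun d = χ} ∨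
      (1 < {d | θ₁.gfun d = χ}.encard ∧ 1 < {d | θ₂.gfun d = χ}.encard)) :
    θ₁.profile = θ₂.profile := by
  have h0 : ∀ a : ℕ∞, 1 < a → a ≠ 0 ∧ a ≠ 1 := fun a ha =>
    ⟨(zero_lt_one.trans ha).ne', ha.ne'⟩
  unfold EConf.profile
  refine Prod.ext ?_ (Prod.ext ?_ (Prod.ext hr hm))
  · ext χ
    rcases H χ with e | ⟨a, b⟩
    · simp only [Set.mem_ofPred_eq, e]
    · exact iff_of_false (h0 _ a).1 (h0 _ b).1
  · ext χ
    rcases H χ with e | ⟨a, b⟩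
    · simp only [Set.mem_ofPred_eq, e]
    · exact iff_of_false (h0 _ a).2 (h0 _ b).2

/-- Adding a fresh data value `e` which copies the data value `a`. -/
theorem exists_inc (θ : EConf A B Q S D h) (a b e : D) (hab : a ≠ b)
    (hg : θ.gfun b = θ.gfun a) (he : e ∉ θ.dataset) :
    ∃ θt : EConf A B Q S D h, θt.r = θ.r ∧ θt.m = θ.m ∧
      (∀ x : D, x ≠ e → θt.dfun x = θ.dfun x ∧ θt.gfun x = θ.gfun x) ∧
      θt.dfun e = {qa ∈ θ.dfun a | qa.2 ≠ TA.topg} ∧ θt.gfun e = θ.gfun a := by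
  have hd := EConf.dfun_empty he
  have hge := EConf.gfun_empty he
  have hfd : (θ.dfun a).Finite := by
    refine (θ.finΔ.image (fun x => (x.1, x.2.1))).subset ?_
    intro qa hq
    exact ⟨_, hq, rfl⟩
  have hfg : (θ.gfun a).Finite := by
    refine (θ.finΓ.image (fun x => x.1)).subset ?_
    intro qa hq
    exact ⟨_, hq, rfl⟩
  refine ⟨⟨θ.Δ ∪ (fun qa : Q × TA Q S => (qa.1, qa.2, e)) ''
      {qa ∈ θ.dfun a | qa.2 ≠ TA.topg},
    θ.Γ ∪ (fun μ : S => (μ, e)) '' θ.gfun a, θ.r, θ.m,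
    θ.finΔ.union ((hfd.subset (Set.sep_subset _ _)).image _), θ.finΓ.union (hfg.image _), ?_⟩,
    rfl, rfl, ?_, ?_, ?_⟩
  · obtain ⟨x, ⟨hx, hc⟩, hu⟩ := θ.uniq
    refine ⟨x, ⟨Or.inl hx, hc⟩, ?_⟩
    rintro y ⟨hy | ⟨μ, hμ, rfl⟩, c, hcy⟩
    · exact hu y ⟨hy, c, hcy⟩
    · exfalso
      have h1 := hu (μ, a) ⟨hμ, c, hcy⟩
      have hμb : μ ∈ θ.gfun b := hg ▸ hμ
      have h2 := hu (μ, b) ⟨hμb, c, hcy⟩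
      exact hab (congrArg Prod.snd (h1.trans h2.symm))
  · intro x hx
    constructor
    · ext qa
      simp [EConf.dfun, Ne.symm hx]
    · ext μ
      simp [EConf.gfun, Ne.symm hx]
  · ext qa
    have : (qa.1, qa.2, e) ∉ θ.Δ := fun hq => he (Or.inl ⟨qa, hq⟩)
    simp [EConf.dfun, this]
  · ext μ
    have : (μ, e) ∉ θ.Γ := fun hq => he (Or.inr ⟨μ, hq⟩)
    simp [EConf.gfun, this]

/-- **Separation lemma (Lemma 3.9)**: if `θ' ⪯ θ` and `d ∈ 𝔻`, then some `θ̃`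
reachable from `θ'` by at most `2^{|S|} + 1` inc-steps satisfies `θ̃ ⪯_f θ` for
some `f` with `f⁻¹(f(d)) = {d}`. -/
theorem inc_separation (A B Q S D : Type) [Fintype A] [Fintype B] [Fintype Q]
    [Fintype S] [Semigroup S] [Infinite D] (h : A × B → S) (hNF1 : NF1 h)
    (θ θ' : EConf A B Q S D h) (hle : ple θ' θ) (d : D) :
    ∃ (θt : EConf A B Q S D h) (f : D → D) (n : ℕ),
      n ≤ 2 ^ Fintype.card S + 1 ∧ relPow inc n θ' θt ∧ pleF f θt θ ∧
      f ⁻¹' {f d} = {d} := by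
  classical
  obtain ⟨g, hp, hr, hg⟩ := hle
  by_cases hinj : g ⁻¹' {g d} = {d}
  · exact ⟨θ', g, 0, Nat.zero_le _, rfl, ⟨hp, hr, hg⟩, hinj⟩
  obtain ⟨d', hd', hne⟩ : ∃ d', g d' = g d ∧ d' ≠ d := by
    by_contra hcon
    push Not at hcon
    apply hinj
    ext x
    constructor
    · exact fun hx => hcon x hx
    · rintro rfl
      rfl
  -- at least two data values of `θ'` carry the same set as `g d`
  have hθ1 : 1 < {x | θ.gfun x = θ'.gfun (g d)}.encard := by
    rw [Set.one_lt_encard_iff]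
    exact ⟨d', d, by simp [← (hg d').2, hd'], by simp [← (hg d).2], hne⟩
  have hθ'1 : 1 < {x | θ'.gfun x = θ'.gfun (g d)}.encard := by
    have h0 := congrArg Prod.fst hp
    have h1 := congrArg (fun p => p.2.1) hp
    have h0' := Set.ext_iff.1 h0 (θ'.gfun (g d))
    have h1' := Set.ext_iff.1 h1 (θ'.gfun (g d))
    simp only [EConf.profile, Set.mem_ofPred_eq] at h0' h1'
    by_contra hlt
    rcases Order.le_one_iff.1 (not_lt.1 hlt) with hz | hz
    · rw [h0'.1 hz] at hθ1
      exact absurd hθ1 (by simp)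
    · rw [h1'.1 hz] at hθ1
      exact absurd hθ1 (by simp)
  obtain ⟨b, hb, hbne⟩ : ∃ b, θ'.gfun b = θ'.gfun (g d) ∧ g d ≠ b := by
    obtain ⟨u, v, hu, hv, huv⟩ := Set.one_lt_encard_iff.1 hθ'1
    by_cases hgu : g d = u
    · exact ⟨v, hv, hgu ▸ huv⟩
    · exact ⟨u, hu, hgu⟩
  have hfin := θ'.dataset_finite
  obtain ⟨e, he⟩ := (hfin.union (Set.toFinite {g d, b})).exists_notMem
  obtain ⟨e₁, he₁⟩ := (hfin.union (Set.toFinite {e})).exists_notMem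
  obtain ⟨e₂, he₂⟩ := (hfin.union (Set.toFinite {e, e₁})).exists_notMem
  simp only [Set.mem_union, Set.mem_insert_iff, Set.mem_singleton_iff, not_or] at he he₁ he₂
  obtain ⟨θt, htr, htm, hold, hnewd, hnewg⟩ := exists_inc θ' (g d) b e hbne hb he.1
  have hprof : θt.profile = θ'.profile := by
    refine profile_eq_of htr htm ?_
    intro χ
    by_cases h1 : χ = θ'.gfun (g d)
    · right
      subst h1
      refine ⟨Set.one_lt_encard_iff.2 ⟨g d, b, ?_, ?_, hbne⟩, hθ'1⟩
      · exact (hold _ (Ne.symm he.2.1)).2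
      · exact (hold _ (Ne.symm he.2.2)).2.trans hb
    · by_cases h2 : χ = ∅
      · right
        subst h2
        constructor
        · refine Set.one_lt_encard_iff.2 ⟨e₁, e₂, ?_, ?_, Ne.symm he₂.2.2⟩
          · exact (hold _ he₁.2).2.trans (EConf.gfun_empty he₁.1)
          · exact (hold _ he₂.2.1).2.trans (EConf.gfun_empty he₂.1)
        · exact Set.one_lt_encard_iff.2 ⟨e₁, e₂, EConf.gfun_empty he₁.1,
            EConf.gfun_empty he₂.1, Ne.symm he₂.2.2⟩
      · left
        ext x
        simp only [Set.mem_ofPred_eq]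
        by_cases hx : x = e
        · subst hx
          rw [hnewg, EConf.gfun_empty he.1]
          exact iff_of_false (Ne.symm h1) (Ne.symm h2)
        · rw [(hold x hx).2]
  have hinc : inc θ' θt :=
    ⟨_, _, ⟨g d, rfl, rfl⟩, ⟨g d, b, hbne, rfl, hb⟩, e, he.1, htr, htm, hold, hnewd, hnewg⟩
  let f : D → D := fun x => if x = d then e else if g x = e then e₁ else g x
  have hfd : f d = e := by simp [f]
  have hf2 : ∀ x, x ≠ d → g x = e → f x = e₁ := fun x h1 h2 => by simp [f, h1, h2]
  have hf3 : ∀ x, x ≠ d → g x ≠ e → f x = g x := fun x h1 h2 => by simp [f, h1, h2]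
  refine ⟨θt, f, 1, Nat.le_add_left _ _, ⟨θt, hinc, rfl⟩, ⟨hprof.trans hp, ?_, ?_⟩, ?_⟩
  · intro y hy
    by_cases hye : y = e
    · exact ⟨d, hfd.trans hye.symm⟩
    have hy' : y ∈ θ'.dataset := by
      by_contra hcon
      rcases hy with ⟨qa, hq⟩ | ⟨μ, hq⟩
      · have h1 : qa ∈ θt.dfun y := hq
        rw [(hold y hye).1, EConf.dfun_empty hcon] at h1
        exact h1
      · have h1 : μ ∈ θt.gfun y := hq
        rw [(hold y hye).2, EConf.gfun_empty hcon] at h1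
        exact h1
    obtain ⟨x, rfl⟩ := hr hy'
    by_cases hx : x = d
    · subst hx
      exact ⟨d', (hf3 d' hne (hd' ▸ hye)).trans hd'⟩
    · exact ⟨x, hf3 x hx hye⟩
  · intro x
    by_cases hx : x = d
    · subst hx
      rw [hfd, hnewd, hnewg]
      exact ⟨(Set.sep_subset _ _).trans (hg x).1, (hg x).2⟩
    by_cases hxe : g x = e
    · rw [hf2 x hx hxe, (hold _ he₁.2).1, (hold _ he₁.2).2, EConf.dfun_empty he₁.1,
        EConf.gfun_empty he₁.1, ← (hg x).2, hxe, EConf.gfun_empty he.1]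
      exact ⟨Set.empty_subset _, rfl⟩
    · rw [hf3 x hx hxe, (hold _ hxe).1, (hold _ hxe).2]
      exact hg x
  · ext x
    simp only [Set.mem_preimage, Set.mem_singleton_iff, hfd]
    constructor
    · intro hx
      by_contra hxd
      by_cases hxe : g x = e
      · exact he₁.2 ((hf2 x hxd hxe).symm.trans hx)
      · exact hxe ((hf3 x hxd hxe).symm.trans hx)
    · rintro rfl
      exact hfd

end ECBUDA
end
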